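/- Let μ_t and ν_t be two absolutely continuous curves in P₂(ℝ^d) on [0,T], with velocity vector fields u_t and v_t respectively (i.e. ∂_t μ_t + ∇·(u_t μ_t) = 0 and ∂_t ν_t + ∇·(v_t ν_t) = 0 in the sense of distributions, with ∫₀ᵀ ∫|u_t|² dμ_t dt < ∞ and ∫₀ᵀ ∫|v_t|² dν_t dt < ∞). Then for almost every t ∈ [0,T], the function t ↦ W₂²(μ_t, ν_t) is differentiable at t and (d/dt) W₂²(μ_t,ν_t) = 2 ∬ ⟨u_t(x) − v_t(y), x − y⟩ dΠ_{μ_t,ν_t}(x,y), where Π_{μ_t,ν_t} is any optimal transport plan (for quadratic cost) from μ_t to ν_t. -/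

import Mathlib

open MeasureTheory Filter Metric Set
open scoped Topology ENNReal NNReal RealInnerProductSpace

noncomputable section

abbrev Rd (d : ℕ) := EuclideanSpace ℝ (Fin d)

namespace MSP

variable {d : ℕ}

/-- The topological support of a measure. -/
def msupport {α : Type*} [TopologicalSpace α] {mα : MeasurableSpace α} (μ : Measure α) :
    Set α :=
  {x | ∀ U : Set α, IsOpen U → x ∈ U → 0 < μ U}

/-- `π` is a transport plan (coupling) between `μ` and `ν`. -/
def IsCoupling (π : Measure (Rd d × Rd d)) (μ ν : Measure (Rd d)) : Prop :=
  π.map Prod.fst = μ ∧ π.map Prod.snd = ν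

/-- The quadratic transport cost of a plan. -/
def cost2 (π : Measure (Rd d × Rd d)) : ℝ≥0∞ :=
  ∫⁻ p, (‖p.1 - p.2‖₊ : ℝ≥0∞) ^ 2 ∂π

/-- The squared quadratic Wasserstein distance (as an extended real). -/
def W2sq (μ ν : Measure (Rd d)) : ℝ≥0∞ :=
  sInf {c | ∃ π : Measure (Rd d × Rd d), IsCoupling π μ ν ∧ c = cost2 π}

/-- The quadratic Wasserstein distance. -/
def W2 (μ ν : Measure (Rd d)) : ℝ :=
  Real.sqrt (W2sq μ ν).toReal

/-- An optimal transport plan for the quadratic cost. -/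
def IsOptimalPlan (π : Measure (Rd d × Rd d)) (μ ν : Measure (Rd d)) : Prop :=
  IsCoupling π μ ν ∧ cost2 π = W2sq μ ν

def HasFiniteSecondMoment (μ : Measure (Rd d)) : Prop :=
  ∫⁻ x, (‖x‖₊ : ℝ≥0∞) ^ 2 ∂μ < ⊤

/-- `μ` belongs to the Wasserstein space `P₂(ℝ^d)`. -/
def IsP2 (μ : Measure (Rd d)) : Prop :=
  IsProbabilityMeasure μ ∧ HasFiniteSecondMoment μ

/-- The set of nearest points of `S` to `x` (metric projection set). -/
def projSet {E : Type*} [MetricSpace E] (S : Set E) (x : E) : Set E :=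
  {a | a ∈ S ∧ dist x a = infDist x S}

/-- `S` is `r`-prox-regular: the metric projection onto `S` is single-valued and
continuous on the open `r`-neighborhood of `S`. -/
def IsProxRegular {E : Type*} [MetricSpace E] (r : ℝ) (S : Set E) : Prop :=
  IsClosed S ∧ ∃ P : E → E,
    (∀ x, infDist x S < r → projSet S x = {P x}) ∧
    ContinuousOn P {x | infDist x S < r}

/-- The proximal normal cone to `S` at `x`. -/
def proxNormalCone {E : Type*} [NormedAddCommGroup E] [InnerProductSpace ℝ E]
    (S : Set E) (x : E) : Set E :=
  {v | ∃ σ : ℝ, 0 ≤ σ ∧ ∀ y ∈ S, ⟪v, y - x⟫ ≤ σ * ‖y - x‖ ^ 2}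

/-- Assumption (A₁) on the nonlocal vector field `𝒱`. -/
def A1 (L : ℝ) (V : Measure (Rd d) → Rd d → Rd d) : Prop :=
  (∀ μ ν : Measure (Rd d), IsP2 μ → IsP2 ν → ∀ x, ‖V μ x - V ν x‖ ≤ L * W2 μ ν) ∧
  (∀ μ : Measure (Rd d), IsP2 μ → ∀ x y, ‖V μ x - V μ y‖ ≤ L * ‖x - y‖) ∧
  (∀ μ : Measure (Rd d), IsP2 μ → ∀ x, ‖V μ x‖ ≤ L) ∧
  (∀ μ : Measure (Rd d), IsP2 μ → Continuous (V μ))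

/-- Assumption (A₂) on the moving viability set `𝐂`. -/
def A2 (T M r : ℝ) (C : ℝ → Set (Rd d)) : Prop :=
  (∀ s ∈ Icc (0:ℝ) T, ∀ t ∈ Icc (0:ℝ) T, hausdorffDist (C s) (C t) ≤ M * |s - t|) ∧
  ∀ t ∈ Icc (0:ℝ) T, IsCompact (C t) ∧ (C t).Nonempty ∧ IsProxRegular r (C t)

/-- `(ρ, v)` solves the continuity equation `∂ₜρ + ∇·(vρ) = 0` on `(0,T)×ℝ^d` in
the sense of distributions. -/
def IsContEqSol (T : ℝ) (ρ : ℝ → Measure (Rd d)) (v : ℝ → Rd d → Rd d) : Prop :=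
  ∀ φ : ℝ → Rd d → ℝ,
    ContDiff ℝ ((⊤ : ℕ∞) : WithTop ℕ∞) (fun p : ℝ × Rd d => φ p.1 p.2) →
    HasCompactSupport (fun p : ℝ × Rd d => φ p.1 p.2) →
    tsupport (fun p : ℝ × Rd d => φ p.1 p.2) ⊆ Ioo (0:ℝ) T ×ˢ (univ : Set (Rd d)) →
    ∫ t in Ioo (0:ℝ) T,
      ∫ x, (deriv (fun s => φ s x) t + ⟪v t x, gradient (φ t) x⟫) ∂(ρ t) = 0

/-- `ρ` is an absolutely continuous curve in `P₂(ℝ^d)` on `[0,T]`. -/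
def IsAbsCont (T : ℝ) (ρ : ℝ → Measure (Rd d)) : Prop :=
  ∃ g : ℝ → ℝ, IntegrableOn g (Icc (0:ℝ) T) ∧
    ∀ s t : ℝ, 0 ≤ s → s ≤ t → t ≤ T → W2 (ρ s) (ρ t) ≤ ∫ τ in Ioc s t, g τ

/-- `ρ` (with Borel velocity field `v`) is a solution of the measure sweeping
process driven by `𝐂` with perturbation `𝒱`. -/
def IsMSPSol (T : ℝ) (V : Measure (Rd d) → Rd d → Rd d) (C : ℝ → Set (Rd d))
    (ρ : ℝ → Measure (Rd d)) (v : ℝ → Rd d → Rd d) : Prop :=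
  (∀ t ∈ Icc (0:ℝ) T, IsP2 (ρ t)) ∧
  IsAbsCont T ρ ∧
  Measurable (fun p : ℝ × Rd d => v p.1 p.2) ∧
  IsContEqSol T ρ v ∧
  (∀ᵐ t ∂(volume.restrict (Icc (0:ℝ) T)),
    ∀ᵐ x ∂(ρ t), V (ρ t) x - v t x ∈ proxNormalCone (C t) x) ∧
  ∀ t ∈ Icc (0:ℝ) T, msupport (ρ t) ⊆ C t

/-- The graph of the set-valued map `𝐂`, as a subset of the euclidean product
`ℝ ×₂ ℝ^d`. -/
def graphSet (T : ℝ) (C : ℝ → Set (Rd d)) : Set (WithLp 2 (ℝ × Rd d)) :=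
  {p | (WithLp.equiv 2 (ℝ × Rd d) p).1 ∈ Icc (0:ℝ) T ∧
       (WithLp.equiv 2 (ℝ × Rd d) p).2 ∈ C ((WithLp.equiv 2 (ℝ × Rd d) p).1)}

/-- Continuity of a curve of measures with respect to `W₂`, on `[0,T]`. -/
def W2ContinuousOn (T : ℝ) (ρ : ℝ → Measure (Rd d)) : Prop :=
  ∀ t₀ ∈ Icc (0:ℝ) T, ∀ ε > (0:ℝ), ∃ δ > (0:ℝ),
    ∀ t ∈ Icc (0:ℝ) T, |t - t₀| < δ → W2 (ρ t) (ρ t₀) < ε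

end MSP

open MSP

namespace MSP

variable {d : ℕ}

section SquareIntegrable

variable {α E : Type*} {mα : MeasurableSpace α} {m : Measure α}
  [NormedAddCommGroup E] [InnerProductSpace ℝ E]

lemma integrable_inner_of_memLp {f g : α → E} (hf : MemLp f 2 m) (hg : MemLp g 2 m) :
    Integrable (fun x => ⟪f x, g x⟫) m := by
  refine (L2.integrable_inner (𝕜 := ℝ) hf.toLp hg.toLp).congr ?_
  filter_upwards [hf.coeFn_toLp, hg.coeFn_toLp] with x h1 h2
  rw [h1, h2]

lemma inner_toLp {f g : α → E} (hf : MemLp f 2 m) (hg : MemLp g 2 m) :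
    ⟪hf.toLp, hg.toLp⟫ = ∫ x, ⟪f x, g x⟫ ∂m := by
  rw [L2.inner_def]
  refine integral_congr_ae ?_
  filter_upwards [hf.coeFn_toLp, hg.coeFn_toLp] with x h1 h2
  rw [h1, h2]

lemma norm_toLp_eq_sqrt {f : α → E} (hf : MemLp f 2 m) :
    ‖hf.toLp‖ = √(∫ x, ‖f x‖ ^ 2 ∂m) := by
  rw [norm_eq_sqrt_real_inner, inner_toLp]
  simp only [real_inner_self_eq_norm_sq]

lemma integrable_norm_sq_of_memLp {f : α → E} (hf : MemLp f 2 m) :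
    Integrable (fun x => ‖f x‖ ^ 2) m := by
  simpa only [real_inner_self_eq_norm_sq] using integrable_inner_of_memLp hf hf

/-- The Cauchy–Schwarz inequality for square integrable vector fields. -/
lemma abs_integral_inner_le {f g : α → E} (hf : MemLp f 2 m) (hg : MemLp g 2 m) :
    |∫ x, ⟪f x, g x⟫ ∂m| ≤ √(∫ x, ‖f x‖ ^ 2 ∂m) * √(∫ x, ‖g x‖ ^ 2 ∂m) := by
  rw [← norm_toLp_eq_sqrt hf, ← norm_toLp_eq_sqrt hg, ← inner_toLp hf hg]
  exact abs_real_inner_le_norm _ _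

/-- The Minkowski inequality for square integrable vector fields. -/
lemma sqrt_integral_norm_add_sq_le {f g : α → E} (hf : MemLp f 2 m) (hg : MemLp g 2 m) :
    √(∫ x, ‖f x + g x‖ ^ 2 ∂m) ≤ √(∫ x, ‖f x‖ ^ 2 ∂m) + √(∫ x, ‖g x‖ ^ 2 ∂m) := by
  have h := norm_toLp_eq_sqrt (hf.add hg)
  simp only [Pi.add_apply] at h
  rw [← norm_toLp_eq_sqrt hf, ← norm_toLp_eq_sqrt hg, ← h, MemLp.toLp_add hf hg]
  exact norm_add_le _ _

end SquareIntegrable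

/-- `w` is orthogonal in `L²(m)` to the gradients of test functions. -/
def IsDivFree (m : Measure (Rd d)) (w : Rd d → Rd d) : Prop :=
  ∀ φ : Rd d → ℝ, ContDiff ℝ ((⊤ : ℕ∞) : WithTop ℕ∞) φ → HasCompactSupport φ →
    ∫ x, fderiv ℝ φ x (w x) ∂m = 0

lemma abs_sub_le_of_fderiv_linear_growth {f : Rd d → ℝ} (hf : Differentiable ℝ f) {C : ℝ}
    (hC : ∀ x, ‖fderiv ℝ f x‖ ≤ C * (1 + ‖x‖)) (x : Rd d) :
    |f x - f 0| ≤ C * (1 + ‖x‖) * ‖x‖ := by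
  have hC0 : 0 ≤ C := by simpa using (norm_nonneg _).trans (hC 0)
  have := (convex_closedBall (0 : Rd d) ‖x‖).norm_image_sub_le_of_norm_fderiv_le
    (f := f) (C := C * (1 + ‖x‖)) (𝕜 := ℝ) (fun z _ => hf z)
    (fun z hz => (hC z).trans (by
      have : ‖z‖ ≤ ‖x‖ := by simpa using hz
      gcongr)) (x := 0) (y := x) (by simp) (by simp)
  simpa using this

/-- A divergence-free field is orthogonal to all smooth gradients of linear growth. -/
lemma IsDivFree.integral_fderiv_eq_zero {m : Measure (Rd d)} [IsProbabilityMeasure m]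
    (hm : MemLp (fun x : Rd d => x) 2 m) {w : Rd d → Rd d} (hw : MemLp w 2 m)
    (hdiv : IsDivFree m w) {f : Rd d → ℝ} (hf : ContDiff ℝ ((⊤ : ℕ∞) : WithTop ℕ∞) f) {C : ℝ}
    (hC : ∀ x, ‖fderiv ℝ f x‖ ≤ C * (1 + ‖x‖)) :
    ∫ x, fderiv ℝ f x (w x) ∂m = 0 := by
  have hC0 : 0 ≤ C := by simpa using (norm_nonneg _).trans (hC 0)
  let ζ : ContDiffBump (0 : Rd d) := ⟨1, 2, one_pos, one_lt_two⟩
  have hζ : ContDiff ℝ ((⊤ : ℕ∞) : WithTop ℕ∞) ζ := ζ.contDiff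
  obtain ⟨M, hM⟩ : ∃ M, ∀ x, ‖fderiv ℝ ζ x‖ ≤ M :=
    (ζ.hasCompactSupport.fderiv ℝ).exists_bound_of_continuous (hζ.continuous_fderiv (by simp))
  have hM0 : 0 ≤ M := (norm_nonneg _).trans (hM 0)
  let r : ℕ → ℝ := fun n => 1 / ((n : ℝ) + 1)
  have hr : ∀ n, 0 < r n := fun n => by positivity
  have hrlim : Tendsto r atTop (𝓝 0) := tendsto_one_div_add_atTop_nhds_zero_nat
  have hderiv : ∀ n x, HasFDerivAt (fun x => ζ (r n • x) * f x)
      (ζ (r n • x) • fderiv ℝ f x + f x • (r n • fderiv ℝ ζ (r n • x))) x := by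
    intro n x
    have h1 : HasFDerivAt (fun x : Rd d => ζ (r n • x)) (r n • fderiv ℝ ζ (r n • x)) x := by
      have h := ((hζ.differentiable (by simp)) (r n • x)).hasFDerivAt.comp x
        ((hasFDerivAt_id x).const_smul (r n))
      convert! h using 1
      ext v; simp
    exact h1.mul ((hf.differentiable (by simp)) x).hasFDerivAt
  have hzero : ∀ n, ∫ x, (ζ (r n • x) • fderiv ℝ f x
      + f x • (r n • fderiv ℝ ζ (r n • x))) (w x) ∂m = 0 := by
    intro n
    rw [← hdiv (fun x => ζ (r n • x) * f x) ((hζ.comp (contDiff_const_smul (r n))).mul hf)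
      ((ζ.hasCompactSupport.comp_smul (hr n).ne').mul_right)]
    simp only [(hderiv n _).fderiv]
  have hbound : ∀ n x, ‖ζ (r n • x) • fderiv ℝ f x + f x • (r n • fderiv ℝ ζ (r n • x))‖
      ≤ (C + M * |f 0| + 2 * M * C) * (1 + ‖x‖) := by
    intro n x
    have h1 : ‖ζ (r n • x) • fderiv ℝ f x‖ ≤ C * (1 + ‖x‖) := by
      rw [norm_smul, Real.norm_of_nonneg ζ.nonneg]
      calc _ ≤ 1 * (C * (1 + ‖x‖)) := by
            gcongr
            · exact ζ.le_one
            · exact hC x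
        _ = _ := one_mul _
    have h2 : ‖f x • (r n • fderiv ℝ ζ (r n • x))‖ ≤ (M * |f 0| + 2 * M * C) * (1 + ‖x‖) := by
      by_cases hx : r n * ‖x‖ ≤ 2
      · have hfx : |f x| ≤ |f 0| + C * (1 + ‖x‖) * ‖x‖ := by
          have := abs_sub_le_of_fderiv_linear_growth (hf.differentiable (by simp)) hC x
          have h3 := abs_sub_abs_le_abs_sub (f x) (f 0)
          linarith
        have hr1 : r n ≤ 1 := by
          simp only [r]; rw [div_le_one (by positivity)]; linarith [(Nat.cast_nonneg n : (0:ℝ) ≤ n)]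
        rw [norm_smul, norm_smul, Real.norm_eq_abs, Real.norm_of_nonneg (hr n).le]
        calc |f x| * (r n * ‖fderiv ℝ ζ (r n • x)‖)
            ≤ (|f 0| + C * (1 + ‖x‖) * ‖x‖) * (r n * M) := by gcongr; exact hM _
          _ = M * (|f 0| * r n + C * (1 + ‖x‖) * (r n * ‖x‖)) := by ring
          _ ≤ M * (|f 0| * (1 + ‖x‖) + C * (1 + ‖x‖) * 2) := by
              gcongr
              linarith [norm_nonneg x]
          _ = _ := by ring
      · have : fderiv ℝ ζ (r n • x) = 0 := by
          have hx' : r n • x ∉ tsupport ζ := by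
            rw [ζ.tsupport_eq]
            simpa [norm_smul, abs_of_pos (hr n)] using hx
          exact image_eq_zero_of_notMem_tsupport
            (fun h => hx' (tsupport_fderiv_subset ℝ h))
        rw [this]; simp only [smul_zero, norm_zero]; positivity
    calc _ ≤ _ := norm_add_le _ _
      _ ≤ _ := add_le_add h1 h2
      _ = _ := by ring
  have hlim : Tendsto (fun n => ∫ x, (ζ (r n • x) • fderiv ℝ f x
      + f x • (r n • fderiv ℝ ζ (r n • x))) (w x) ∂m) atTop
      (𝓝 (∫ x, fderiv ℝ f x (w x) ∂m)) := by
    refine tendsto_integral_of_dominated_convergence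
      (fun x => (C + M * |f 0| + 2 * M * C) * ((1 + ‖x‖) * ‖w x‖)) ?_ ?_ ?_ ?_
    · intro n
      have hc : Continuous fun x => ζ (r n • x) • fderiv ℝ f x
          + f x • (r n • fderiv ℝ ζ (r n • x)) := by
        have h1 := hζ.continuous_fderiv (by simp)
        have h2 := hf.continuous_fderiv (by simp)
        have h3 := hf.continuous
        have h4 := hζ.continuous
        fun_prop
      exact (isBoundedBilinearMap_apply.continuous.comp_aestronglyMeasurable
        (hc.aestronglyMeasurable.prodMk hw.1))
    · refine Integrable.const_mul ?_ _
      have h1 : MemLp (fun x : Rd d => 1 + ‖x‖) 2 m := (memLp_const (1 : ℝ)).add hm.norm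
      exact h1.integrable_mul hw.norm
    · intro n
      refine ae_of_all _ fun x => ?_
      calc _ ≤ _ := ContinuousLinearMap.le_opNorm _ _
        _ ≤ (C + M * |f 0| + 2 * M * C) * (1 + ‖x‖) * ‖w x‖ := by gcongr; exact hbound n x
        _ = _ := by ring
    · refine ae_of_all _ fun x => ?_
      have h1 : Tendsto (fun n => ζ (r n • x)) atTop (𝓝 1) := by
        have : Tendsto (fun n => ζ (r n • x)) atTop (𝓝 (ζ ((0 : ℝ) • x))) :=
          (hζ.continuous.tendsto _).comp (hrlim.smul_const x)
        have h0 : ζ 0 = 1 := ζ.one_of_mem_closedBall (by simp [ζ])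
        simpa [h0] using this
      have h2 : Tendsto (fun n => r n • fderiv ℝ ζ (r n • x) (w x)) atTop (𝓝 0) := by
        refine squeeze_zero_norm (a := fun n => r n * (M * ‖w x‖)) (fun n => ?_)
          (by simpa using hrlim.mul_const (M * ‖w x‖))
        rw [norm_smul, Real.norm_of_nonneg (hr n).le]
        have h3 := ContinuousLinearMap.le_of_opNorm_le (fderiv ℝ ζ (r n • x)) (hM _) (w x)
        have h4 := (hr n).le
        gcongr
      have h3 := (h1.mul_const (fderiv ℝ f x (w x))).add (h2.const_mul (f x))
      simpa using h3
  exact tendsto_nhds_unique hlim (by simp only [hzero]; exact tendsto_const_nhds)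

/-- A Lipschitz convex function is a uniform limit of smooth Lipschitz convex functions. -/
lemma exists_contDiff_convexOn_approx {ψ : Rd d → ℝ} {K : ℝ≥0} (hψ : ConvexOn ℝ univ ψ)
    (hL : LipschitzWith K ψ) {r : ℝ} (hr : 0 < r) :
    ∃ g : Rd d → ℝ, ContDiff ℝ ((⊤ : ℕ∞) : WithTop ℕ∞) g ∧ ConvexOn ℝ univ g ∧
      LipschitzWith K g ∧ ∀ x, |g x - ψ x| ≤ K * r := by
  let b : ContDiffBump (0 : Rd d) := ⟨r / 2, r, half_pos hr, half_lt_self hr⟩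
  let ρ : Rd d → ℝ := b.normed volume
  have hρ0 : ∀ t, 0 ≤ ρ t := fun t => b.nonneg_normed t
  have hρ1 : ∫ t, ρ t = 1 := b.integral_normed
  have hρc : Continuous ρ := b.contDiff_normed.continuous (n := 0)
  have hρs : HasCompactSupport ρ := b.hasCompactSupport_normed
  have hint : ∀ x, Integrable fun t => ρ t * ψ (x - t) := fun x =>
    (hρc.mul (hL.continuous.comp (by fun_prop))).integrable_of_hasCompactSupport hρs.mul_right
  have hρi : Integrable ρ := hρc.integrable_of_hasCompactSupport hρs
  refine ⟨fun x => ∫ t, ρ t * ψ (x - t), ?_, ?_, ?_, ?_⟩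
  · exact b.hasCompactSupport_normed.contDiff_convolution_left (ContinuousLinearMap.lsmul ℝ ℝ)
      b.contDiff_normed hL.continuous.locallyIntegrable
  · refine ⟨convex_univ, fun x _ y _ α β hα hβ hαβ => ?_⟩
    simp only [smul_eq_mul]
    rw [← integral_const_mul, ← integral_const_mul,
      ← integral_add ((hint x).const_mul α) ((hint y).const_mul β)]
    refine integral_mono (hint _) (((hint x).const_mul α).add ((hint y).const_mul β)) fun t => ?_
    have h := hψ.2 (mem_univ (x - t)) (mem_univ (y - t)) hα hβ hαβ
    have e : α • (x - t) + β • (y - t) = α • x + β • y - t := by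
      rw [smul_sub, smul_sub, ← sub_eq_zero]
      calc _ = t - (α + β) • t := by rw [add_smul]; abel
        _ = 0 := by rw [hαβ, one_smul, sub_self]
    rw [e] at h
    simp only [smul_eq_mul] at h
    calc _ ≤ ρ t * (α * ψ (x - t) + β * ψ (y - t)) := mul_le_mul_of_nonneg_left h (hρ0 t)
      _ = _ := by ring
  · refine LipschitzWith.of_dist_le_mul fun x y => ?_
    rw [Real.dist_eq, ← integral_sub (hint x) (hint y), ← Real.norm_eq_abs]
    calc _ ≤ ∫ t, ρ t * (K * dist x y) := by
          refine norm_integral_le_of_norm_le (hρi.mul_const _) (ae_of_all _ fun t => ?_)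
          rw [← mul_sub, norm_mul, Real.norm_of_nonneg (hρ0 t)]
          have := hL.dist_le_mul (x - t) (y - t)
          rw [dist_sub_right] at this
          exact mul_le_mul_of_nonneg_left this (hρ0 t)
      _ = _ := by rw [integral_mul_const, hρ1, one_mul]
  · intro x
    have e : (∫ t, ρ t * ψ (x - t)) - ψ x = ∫ t, ρ t * (ψ (x - t) - ψ x) := by
      simp only [mul_sub]
      rw [integral_sub (hint x) (hρi.mul_const _), integral_mul_const, hρ1, one_mul]
    rw [e, ← Real.norm_eq_abs]
    calc _ ≤ ∫ t, ρ t * (K * r) := by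
          refine norm_integral_le_of_norm_le (hρi.mul_const _) (ae_of_all _ fun t => ?_)
          rw [norm_mul, Real.norm_of_nonneg (hρ0 t)]
          by_cases ht : ρ t = 0
          · simp [ht]
          · have ht' : t ∈ ball (0 : Rd d) r := by
              have : t ∈ Function.support (b.normed volume) := ht
              rwa [b.support_normed_eq] at this
            refine mul_le_mul_of_nonneg_left ?_ (hρ0 t)
            calc _ ≤ K * dist (x - t) x := hL.dist_le_mul _ _
              _ ≤ K * r := by
                gcongr
                simpa [dist_eq_norm] using (mem_ball_zero_iff.1 ht').le
      _ = _ := by rw [integral_mul_const, hρ1, one_mul]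

/-- If `y` is a subgradient of `ψ` at `x`, then derivatives of a smooth convex approximation of
`ψ` at points shifted in a direction `e` dominate `y` in the direction `e`. -/
lemma inner_le_fderiv_of_subgradient {ψ g : Rd d → ℝ} (hg : ConvexOn ℝ univ g)
    (hgd : Differentiable ℝ g) {δ : ℝ} (hδ : ∀ x, |g x - ψ x| ≤ δ) {x y : Rd d}
    (hy : ∀ z, ψ x + ⟪y, z - x⟫ ≤ ψ z) (e : Rd d) {s : ℝ} (hs : 0 < s) :
    ⟪y, e⟫ - 2 * δ / s ≤ fderiv ℝ g (x + s • e) e := by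
  have hd : HasDerivAt (fun t : ℝ => g (x + t • e)) (fderiv ℝ g (x + s • e) e) s := by
    have h1 : HasDerivAt (fun t : ℝ => x + t • e) e s := by
      simpa using ((hasDerivAt_id s).smul_const e).const_add x
    exact (hgd _).hasFDerivAt.comp_hasDerivAt s h1
  have hc : ConvexOn ℝ univ fun t : ℝ => g (x + t • e) := by
    have := hg.comp_affineMap (AffineMap.lineMap x (x + e) : ℝ →ᵃ[ℝ] Rd d)
    simpa [Function.comp_def, AffineMap.lineMap_apply, add_comm] using this
  have h1 := hc.slope_le_of_hasDerivAt (mem_univ 0) (mem_univ s) hs hd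
  rw [slope_def_field] at h1
  refine le_trans ?_ h1
  have h2 := hy (x + s • e)
  rw [add_sub_cancel_left, inner_smul_right] at h2
  have h3 := abs_le.1 (hδ (x + s • e))
  have h4 := abs_le.1 (hδ x)
  rw [le_div_iff₀ (by linarith), zero_smul, add_zero, sub_zero, sub_mul, div_mul_cancel₀ _ hs.ne']
  linarith

lemma hasFDerivAt_comp_add_smul {g : Rd d → ℝ} {v : Rd d → Rd d} (hg : Differentiable ℝ g)
    (hv : Differentiable ℝ v) (s : ℝ) (x : Rd d) :
    HasFDerivAt (fun x => g (x + s • v x))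
      ((fderiv ℝ g (x + s • v x)).comp (ContinuousLinearMap.id ℝ (Rd d) + s • fderiv ℝ v x)) x :=
  (hg _).hasFDerivAt.comp x ((hasFDerivAt_id x).add ((hv x).hasFDerivAt.const_smul s))

lemma norm_fderiv_comp_add_smul_le {g : Rd d → ℝ} {v : Rd d → Rd d} (hg : Differentiable ℝ g)
    (hv : Differentiable ℝ v) {K M : ℝ} (hgK : ∀ x, ‖fderiv ℝ g x‖ ≤ K)
    (hM : ∀ x, ‖fderiv ℝ v x‖ ≤ M) {s : ℝ} (hs : 0 ≤ s) (x : Rd d) :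
    ‖fderiv ℝ (fun x => g (x + s • v x)) x‖ ≤ K * (1 + s * M) := by
  rw [(hasFDerivAt_comp_add_smul hg hv s x).fderiv]
  refine (ContinuousLinearMap.opNorm_comp_le _ _).trans ?_
  refine mul_le_mul (hgK _) ?_ (norm_nonneg _) ((norm_nonneg _).trans (hgK 0))
  refine (norm_add_le _ _).trans ?_
  rw [norm_smul, Real.norm_of_nonneg hs]
  exact add_le_add ContinuousLinearMap.norm_id_le (mul_le_mul_of_nonneg_left (hM x) hs)

/-- A subgradient of `ψ` at `x` is almost dominated by the derivative at `x` of a smooth convex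
approximation of `ψ` composed with the perturbation `id + s • v` of the identity. -/
lemma inner_le_fderiv_comp_add_smul {ψ g : Rd d → ℝ} {v : Rd d → Rd d} (hg : ConvexOn ℝ univ g)
    (hgd : Differentiable ℝ g) (hvd : Differentiable ℝ v) {K M s : ℝ} (hs : 0 < s)
    (hgK : ∀ x, ‖fderiv ℝ g x‖ ≤ K) (hM : ∀ x, ‖fderiv ℝ v x‖ ≤ M)
    (hgψ : ∀ x, |g x - ψ x| ≤ K * s ^ 2) {x y : Rd d} (hyK : ‖y‖ ≤ K)
    (hy : ∀ z, ψ x + ⟪y, z - x⟫ ≤ ψ z) (w : Rd d) :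
    ⟪y, w⟫ ≤ fderiv ℝ (fun x => g (x + s • v x)) x w
      + (2 * K * s + 2 * K * ‖w - v x‖ + K * s * M * ‖w‖) := by
  rw [(hasFDerivAt_comp_add_smul hgd hvd s x).fderiv]
  have h1 := inner_le_fderiv_of_subgradient hg hgd hgψ hy (v x) hs
  have h2 : 2 * (K * s ^ 2) / s = 2 * K * s := by field_simp
  rw [h2] at h1
  have h3 : |fderiv ℝ g (x + s • v x) (w - v x)| ≤ K * ‖w - v x‖ :=
    ContinuousLinearMap.le_of_opNorm_le _ (hgK _) _
  have h4 : |fderiv ℝ g (x + s • v x) (fderiv ℝ v x w)| ≤ K * (M * ‖w‖) :=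
    (ContinuousLinearMap.le_of_opNorm_le _ (hgK _) _).trans
      (mul_le_mul_of_nonneg_left (ContinuousLinearMap.le_of_opNorm_le _ (hM _) _)
        ((norm_nonneg _).trans (hgK 0)))
  have h5 : |⟪y, w - v x⟫| ≤ K * ‖w - v x‖ :=
    (abs_real_inner_le_norm _ _).trans (mul_le_mul_of_nonneg_right hyK (norm_nonneg _))
  rw [map_sub] at h3
  rw [inner_sub_right] at h5
  have h3' := (abs_le.1 h3).1
  have h4' := mul_le_mul_of_nonneg_left (abs_le.1 h4).1 hs.le
  have h5' := (abs_le.1 h5).2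
  simp only [ContinuousLinearMap.comp_apply, add_apply,
    ContinuousLinearMap.id_apply, smul_apply, map_add, map_smul, smul_eq_mul]
  have e : s * -(K * (M * ‖w‖)) = -(K * s * M * ‖w‖) := by ring
  rw [e] at h4'
  linarith

/-- A divergence-free field is almost orthogonal to subgradients of a Lipschitz convex function. -/
lemma IsDivFree.setIntegral_inner_le {m : Measure (Rd d)} [IsProbabilityMeasure m]
    (hm : MemLp (fun x : Rd d => x) 2 m) {w : Rd d → Rd d} (hw : MemLp w 2 m)
    (hdiv : IsDivFree m w) {π : Measure (Rd d × Rd d)} (hπ : MeasurePreserving Prod.fst π m)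
    {ψ : Rd d → ℝ} {K : ℝ≥0} (hψ : ConvexOn ℝ univ ψ) (hL : LipschitzWith K ψ)
    {A : Set (Rd d × Rd d)} (hA : MeasurableSet A) (hAK : ∀ p ∈ A, ‖p.2‖ ≤ K)
    (hsub : ∀ p ∈ A, ∀ z, ψ p.1 + ⟪p.2, z - p.1⟫ ≤ ψ z) :
    ∫ p in A, ⟪p.2, w p.1⟫ ∂π ≤ K * ∫ p in Aᶜ, ‖w p.1‖ ∂π := by
  have hprob : IsProbabilityMeasure π := ⟨by
    have := hπ.measure_preimage (s := univ) MeasurableSet.univ.nullMeasurableSet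
    simpa using this⟩
  have hwi : Integrable w m := hw.integrable one_le_two
  have hwπ : Integrable (fun p : Rd d × Rd d => w p.1) π := hπ.integrable_comp_of_integrable hwi
  have hin : IntegrableOn (fun p : Rd d × Rd d => ⟪p.2, w p.1⟫) A π := by
    refine Integrable.mono' ((hwπ.norm.const_mul K).integrableOn)
      ((measurable_snd.aestronglyMeasurable.inner (𝕜 := ℝ) hwπ.1).restrict) ?_
    filter_upwards [ae_restrict_mem hA] with p hp
    exact (norm_inner_le_norm _ _).trans (by gcongr; exact hAK p hp)
  set I := ∫ p in A, ⟪p.2, w p.1⟫ ∂π with hI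
  set J := ∫ p in Aᶜ, ‖w p.1‖ ∂π with hJ
  set N := ∫ x, ‖w x‖ ∂m with hN
  have hN0 : 0 ≤ N := integral_nonneg fun _ => norm_nonneg _
  suffices H : ∀ ε : ℝ, 0 < ε → I ≤ K * J + 2 * K * ε by
    refine le_of_forall_pos_le_add fun η hη => ?_
    refine (H (η / (2 * K + 1)) (by positivity)).trans ?_
    have : 2 * K * (η / (2 * K + 1)) ≤ η := by
      rw [← mul_div_assoc, div_le_iff₀ (by positivity)]
      nlinarith [K.2]
    linarith
  intro ε hε
  obtain ⟨v, hvs, hvc, hv⟩ := (hw.mono_exponent one_le_two).exist_eLpNorm_sub_le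
    ENNReal.one_ne_top le_rfl hε
  have hvi : Integrable v m := hvc.continuous.integrable_of_hasCompactSupport hvs
  have hvε : ∫ x, ‖w x - v x‖ ∂m ≤ ε := by
    rw [eLpNorm_one_eq_lintegral_enorm] at hv
    have h := integral_norm_eq_lintegral_enorm (hwi.sub hvi).1
    simp only [Pi.sub_apply] at h hv
    rw [h]
    exact ENNReal.toReal_le_of_le_ofReal hε.le hv
  obtain ⟨M, hM⟩ : ∃ M, ∀ x, ‖fderiv ℝ v x‖ ≤ M :=
    (hvs.fderiv ℝ).exists_bound_of_continuous (hvc.continuous_fderiv (by simp))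
  have hM0 : 0 ≤ M := (norm_nonneg _).trans (hM 0)
  have key : ∀ s : ℝ, 0 < s → I ≤ K * J + 2 * K * ε + s * (2 * K + K * M * N) := by
    intro s hs
    obtain ⟨g, hgc, hgconv, hgL, hgψ⟩ := exists_contDiff_convexOn_approx hψ hL
      (r := s ^ 2) (by positivity)
    have hgd : Differentiable ℝ g := hgc.differentiable (by simp)
    have hvd : Differentiable ℝ v := hvc.differentiable (by simp)
    have hgK : ∀ x, ‖fderiv ℝ g x‖ ≤ K := fun x => norm_fderiv_le_of_lipschitz ℝ hgL
    have hfc : ContDiff ℝ ((⊤ : ℕ∞) : WithTop ℕ∞) fun x => g (x + s • v x) :=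
      hgc.comp (contDiff_id.add (hvc.const_smul s))
    have hfb : ∀ x, ‖fderiv ℝ (fun x => g (x + s • v x)) x‖ ≤ K * (1 + s * M) :=
      norm_fderiv_comp_add_smul_le hgd hvd hgK hM hs.le
    have hz : ∫ x, fderiv ℝ (fun x => g (x + s • v x)) x (w x) ∂m = 0 := by
      refine hdiv.integral_fderiv_eq_zero hm hw hfc (C := K * (1 + s * M)) fun x => ?_
      refine (hfb x).trans (le_mul_of_one_le_right (by positivity) ?_)
      linarith [norm_nonneg x]
    have hfi : Integrable (fun x => fderiv ℝ (fun x => g (x + s • v x)) x (w x)) m := by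
      refine Integrable.mono' (hwi.norm.const_mul (K * (1 + s * M))) ?_
        (ae_of_all _ fun x => ContinuousLinearMap.le_of_opNorm_le _ (hfb x) _)
      exact (isBoundedBilinearMap_apply.continuous.comp_aestronglyMeasurable
        ((hfc.continuous_fderiv (by simp)).aestronglyMeasurable.prodMk hw.1))
    have hpt : ∀ p : Rd d × Rd d,
        A.indicator (fun p => ⟪p.2, w p.1⟫) p ≤ fderiv ℝ (fun x => g (x + s • v x)) p.1 (w p.1)
          + (K * Aᶜ.indicator (fun p => ‖w p.1‖) p + 2 * K * s + 2 * K * ‖w p.1 - v p.1‖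
            + K * s * M * ‖w p.1‖) := by
      rintro ⟨x, y⟩
      by_cases hp : (x, y) ∈ A
      · rw [indicator_of_mem hp, indicator_of_notMem (by simpa using hp)]
        have h1 := inner_le_fderiv_comp_add_smul hgconv hgd hvd hs hgK hM hgψ (hAK _ hp)
          (hsub _ hp) (w x)
        simp only at h1 ⊢
        linarith
      · rw [indicator_of_notMem hp, indicator_of_mem (by simpa using hp)]
        have h1 := (abs_le.1 (ContinuousLinearMap.le_of_opNorm_le _ (hfb x) (w x))).1
        have h2 : 0 ≤ 2 * K * s + 2 * K * ‖w x - v x‖ := by positivity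
        have h3 : K * (1 + s * M) * ‖w x‖ = K * ‖w x‖ + K * s * M * ‖w x‖ := by ring
        rw [h3] at h1
        simp only
        linarith
    have e1 : ∫ p, fderiv ℝ (fun x => g (x + s • v x)) p.1 (w p.1) ∂π = 0 := by
      rw [← hz, ← hπ.map_eq, integral_map hπ.aemeasurable (by rw [hπ.map_eq]; exact hfi.1)]
    have i1 : Integrable (fun p : Rd d × Rd d =>
        fderiv ℝ (fun x => g (x + s • v x)) p.1 (w p.1)) π := hπ.integrable_comp_of_integrable hfi
    have i2 : Integrable (fun p : Rd d × Rd d => ‖w p.1 - v p.1‖) π :=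
      hπ.integrable_comp_of_integrable (hwi.sub hvi).norm
    have e2 : ∫ p : Rd d × Rd d, ‖w p.1 - v p.1‖ ∂π ≤ ε := by
      refine le_trans (le_of_eq ?_) hvε
      rw [← hπ.map_eq, integral_map hπ.aemeasurable (by rw [hπ.map_eq]; exact (hwi.sub hvi).norm.1)]
    have e3 : ∫ p : Rd d × Rd d, ‖w p.1‖ ∂π = N := by
      rw [hN, ← hπ.map_eq, integral_map hπ.aemeasurable (by rw [hπ.map_eq]; exact hwi.norm.1)]
    have i3 := (hwπ.norm.indicator hA.compl).const_mul (K : ℝ)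
    have j1 : Integrable (fun p => K * Aᶜ.indicator (fun p : Rd d × Rd d => ‖w p.1‖) p
        + 2 * K * s) π := i3.add (integrable_const _)
    have j2 : Integrable (fun p => K * Aᶜ.indicator (fun p : Rd d × Rd d => ‖w p.1‖) p
        + 2 * K * s + 2 * K * ‖w p.1 - v p.1‖) π := j1.add (i2.const_mul _)
    have j3 : Integrable (fun p => K * Aᶜ.indicator (fun p : Rd d × Rd d => ‖w p.1‖) p
        + 2 * K * s + 2 * K * ‖w p.1 - v p.1‖ + K * s * M * ‖w p.1‖) π :=
      j2.add (hwπ.norm.const_mul _)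
    have hmono := integral_mono ((integrable_indicator_iff hA).2 hin) (i1.add j3) hpt
    rw [integral_indicator hA] at hmono
    refine hmono.trans ?_
    have : ∫ p, (fderiv ℝ (fun x => g (x + s • v x)) p.1 (w p.1)
          + (K * Aᶜ.indicator (fun p => ‖w p.1‖) p + 2 * K * s + 2 * K * ‖w p.1 - v p.1‖
            + K * s * M * ‖w p.1‖)) ∂π
        = 0 + (K * J + 2 * K * s + 2 * K * (∫ p, ‖w p.1 - v p.1‖ ∂π) + K * s * M * N) := by
      rw [integral_add i1 j3, integral_add j2 (hwπ.norm.const_mul _),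
        integral_add j1 (i2.const_mul _), integral_add i3 (integrable_const _),
        integral_const, probReal_univ, one_smul, integral_const_mul,
        integral_const_mul (2 * K : ℝ), integral_const_mul (K * s * M : ℝ),
        integral_indicator hA.compl, e1, e3]
    refine le_trans (le_of_eq this) ?_
    have h2 := mul_le_mul_of_nonneg_left e2 (by positivity : (0:ℝ) ≤ 2 * K)
    nlinarith
  refine ge_of_tendsto (x := 𝓝[>] (0:ℝ))
    (f := fun s : ℝ => K * J + 2 * K * ε + s * (2 * K + K * M * N)) ?_ ?_
  · have : Tendsto (fun s : ℝ => K * J + 2 * K * ε + s * (2 * K + K * M * N)) (𝓝 0)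
        (𝓝 (K * J + 2 * K * ε + 0 * (2 * K + K * M * N))) :=
      tendsto_const_nhds.add (tendsto_id.mul_const _)
    rw [zero_mul, add_zero] at this
    exact this.mono_left nhdsWithin_le_nhds
  · filter_upwards [self_mem_nhdsWithin] with s hs using key s hs

/-- Cyclical monotonicity of a subset of `ℝ^d × ℝ^d`. -/
def IsCyclicallyMonotone (S : Set (Rd d × Rd d)) : Prop :=
  ∀ (n : ℕ) (f : ℕ → Rd d × Rd d), (∀ i, f i ∈ S) →
    ∑ i ∈ Finset.range n, ⟪(f i).2, (f (i + 1)).1 - (f i).1⟫ + ⟪(f n).2, (f 0).1 - (f n).1⟫ ≤ 0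

lemma IsCyclicallyMonotone.mono {S S' : Set (Rd d × Rd d)} (h : IsCyclicallyMonotone S)
    (hS : S' ⊆ S) : IsCyclicallyMonotone S' :=
  fun n f hf => h n f fun i => hS (hf i)

/-- The theorem of Rockafellar, for a set with bounded second projection. -/
lemma IsCyclicallyMonotone.exists_convexOn_lipschitzWith {S : Set (Rd d × Rd d)}
    (hS : IsCyclicallyMonotone S) (hne : S.Nonempty) {K : ℝ≥0} (hK : ∀ p ∈ S, ‖p.2‖ ≤ K) :
    ∃ ψ : Rd d → ℝ, ConvexOn ℝ univ ψ ∧ LipschitzWith K ψ ∧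
      ∀ p ∈ S, ∀ z, ψ p.1 + ⟪p.2, z - p.1⟫ ≤ ψ z := by
  obtain ⟨p₀, hp₀⟩ := hne
  let ι := {q : ℕ × (ℕ → Rd d × Rd d) // (∀ i, q.2 i ∈ S) ∧ q.2 0 = p₀}
  let L : ι → Rd d → ℝ := fun q z =>
    ∑ i ∈ Finset.range q.1.1, ⟪(q.1.2 i).2, (q.1.2 (i + 1)).1 - (q.1.2 i).1⟫
      + ⟪(q.1.2 q.1.1).2, z - (q.1.2 q.1.1).1⟫
  have hLadd : ∀ q z z', L q z = L q z' + ⟪(q.1.2 q.1.1).2, z - z'⟫ := by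
    intro q z z'
    simp only [L, inner_sub_right]
    ring
  have hLip : ∀ q z z', L q z ≤ L q z' + K * dist z z' := by
    intro q z z'
    rw [hLadd q z z', dist_eq_norm]
    gcongr
    exact (real_inner_le_norm _ _).trans (by gcongr; exact hK _ (q.2.1 _))
  have hbdd : ∀ z, BddAbove (range fun q => L q z) := by
    refine fun z => ⟨0 + K * dist z p₀.1, ?_⟩
    rintro _ ⟨q, rfl⟩
    refine (hLip q z p₀.1).trans ?_
    gcongr
    have := hS q.1.1 q.1.2 q.2.1
    rwa [q.2.2] at this
  have : Nonempty ι := ⟨⟨⟨0, fun _ => p₀⟩, fun _ => hp₀, rfl⟩⟩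
  refine ⟨fun z => ⨆ q, L q z, ⟨convex_univ, fun x _ y _ α β hα hβ hαβ => ciSup_le fun q => ?_⟩,
    LipschitzWith.of_le_add_mul _ fun x y => ciSup_le fun q => ?_, fun p hp z => ?_⟩
  · have e : L q (α • x + β • y) = α • L q x + β • L q y := by
      obtain rfl : β = 1 - α := by linarith
      simp only [L, inner_sub_right, inner_add_right, inner_smul_right, smul_eq_mul]
      ring
    rw [e]
    exact add_le_add (smul_le_smul_of_nonneg_left (le_ciSup (hbdd x) q) hα)
      (smul_le_smul_of_nonneg_left (le_ciSup (hbdd y) q) hβ)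
  · exact (hLip q x y).trans (by gcongr; exact le_ciSup (hbdd y) q)
  · rw [← le_sub_iff_add_le]
    refine ciSup_le fun q => ?_
    rw [le_sub_iff_add_le]
    let f : ℕ → Rd d × Rd d := fun i => if i ≤ q.1.1 then q.1.2 i else p
    have hf : ∀ i, i ≤ q.1.1 → f i = q.1.2 i := fun i hi => if_pos hi
    have hfn : f (q.1.1 + 1) = p := if_neg (by omega)
    let q' : ι := ⟨⟨q.1.1 + 1, f⟩, fun i => by
      by_cases hi : i ≤ q.1.1
      · change f i ∈ S
        rw [hf i hi]
        exact q.2.1 i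
      · change f i ∈ S
        rwa [show f i = p from if_neg hi], (hf 0 (Nat.zero_le _)).trans q.2.2⟩
    refine le_trans (le_of_eq ?_) (le_ciSup (hbdd z) q')
    simp only [L, q', Finset.sum_range_succ, hfn, hf _ le_rfl]
    congr 2
    refine Finset.sum_congr rfl fun i hi => ?_
    have := Finset.mem_range.1 hi
    rw [hf i this.le, hf (i + 1) this]

/-- The cyclic sum that is nonpositive on cyclically monotone sets. -/
def cyclicSum {n : ℕ} (ω : Fin (n + 1) → Rd d × Rd d) : ℝ :=
  ∑ i, ⟪(ω i).2, (ω (i + 1)).1 - (ω i).1⟫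

lemma continuous_cyclicSum {n : ℕ} :
    Continuous (cyclicSum : (Fin (n + 1) → Rd d × Rd d) → ℝ) := by
  unfold cyclicSum
  fun_prop

lemma nnnorm_sq_eq_ofReal (v : Rd d) : (‖v‖₊ : ℝ≥0∞) ^ 2 = ENNReal.ofReal (‖v‖ ^ 2) := by
  rw [ENNReal.ofReal_pow (norm_nonneg _), ofReal_norm, enorm_eq_nnnorm]

lemma sum_cyclic_shift_norm_sq {n : ℕ} (ω : Fin (n + 1) → Rd d × Rd d) :
    ∑ i, ‖(ω (i + 1)).1 - (ω i).2‖ ^ 2 = ∑ i, ‖(ω i).1 - (ω i).2‖ ^ 2 - 2 * cyclicSum ω := by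
  have h : ∑ i, ‖(ω (i + 1)).1‖ ^ 2 = ∑ i, ‖(ω i).1‖ ^ 2 :=
    Fintype.sum_equiv (Equiv.addRight 1) _ _ fun _ => rfl
  rw [← sub_eq_zero] at h ⊢
  rw [← h, cyclicSum, Finset.mul_sum, ← Finset.sum_sub_distrib, ← Finset.sum_sub_distrib,
    ← Finset.sum_sub_distrib]
  refine Finset.sum_congr rfl fun i _ => ?_
  rw [norm_sub_sq_real, norm_sub_sq_real, inner_sub_right, real_inner_comm, real_inner_comm (ω i).2]
  ring

lemma sum_cyclic_shift_nnnorm_sq {n : ℕ} (ω : Fin (n + 1) → Rd d × Rd d) :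
    ∑ i, (‖(ω (i + 1)).1 - (ω i).2‖₊ : ℝ≥0∞) ^ 2
      = ENNReal.ofReal (∑ i, ‖(ω i).1 - (ω i).2‖ ^ 2 - 2 * cyclicSum ω) := by
  simp only [nnnorm_sq_eq_ofReal]
  rw [← ENNReal.ofReal_sum_of_nonneg fun _ _ => by positivity, sum_cyclic_shift_norm_sq]

/-- The cyclic rearrangement of the points of `ω` when this lowers the cost. -/
def cyclicRearrange {n : ℕ} (i : Fin (n + 1)) (ω : Fin (n + 1) → Rd d × Rd d) : Rd d × Rd d :=
  open Classical in if 0 < cyclicSum ω then ((ω (i + 1)).1, (ω i).2) else ω i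

lemma measurable_cyclicRearrange {n : ℕ} (i : Fin (n + 1)) :
    Measurable (cyclicRearrange i : (Fin (n + 1) → Rd d × Rd d) → Rd d × Rd d) := by
  refine Measurable.ite (measurableSet_lt measurable_const continuous_cyclicSum.measurable) ?_ ?_
  · fun_prop
  · fun_prop

lemma cyclicRearrange_snd {n : ℕ} (i : Fin (n + 1)) (ω : Fin (n + 1) → Rd d × Rd d) :
    (cyclicRearrange i ω).2 = (ω i).2 := by
  unfold cyclicRearrange
  split_ifs <;> rfl

lemma sum_comp_cyclicRearrange_fst {n : ℕ} (ω : Fin (n + 1) → Rd d × Rd d) (g : Rd d → ℝ≥0∞) :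
    ∑ i, g (cyclicRearrange i ω).1 = ∑ i, g (ω i).1 := by
  unfold cyclicRearrange
  split_ifs
  · exact Fintype.sum_equiv (Equiv.addRight 1) _ _ fun _ => rfl
  · rfl

lemma sum_nnnorm_sq_cyclicRearrange_le {n : ℕ} (ω : Fin (n + 1) → Rd d × Rd d) :
    ∑ i, (‖(cyclicRearrange i ω).1 - (cyclicRearrange i ω).2‖₊ : ℝ≥0∞) ^ 2
      ≤ ∑ i, (‖(ω i).1 - (ω i).2‖₊ : ℝ≥0∞) ^ 2 := by
  unfold cyclicRearrange
  split_ifs with h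
  · simp only
    rw [sum_cyclic_shift_nnnorm_sq]
    simp only [nnnorm_sq_eq_ofReal]
    rw [← ENNReal.ofReal_sum_of_nonneg fun _ _ => by positivity]
    exact ENNReal.ofReal_le_ofReal (by linarith)
  · exact le_rfl

lemma sum_nnnorm_sq_cyclicRearrange_lt {n : ℕ} {ω : Fin (n + 1) → Rd d × Rd d}
    (h : 0 < cyclicSum ω) :
    ∑ i, (‖(cyclicRearrange i ω).1 - (cyclicRearrange i ω).2‖₊ : ℝ≥0∞) ^ 2
      < ∑ i, (‖(ω i).1 - (ω i).2‖₊ : ℝ≥0∞) ^ 2 := by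
  have h0 : 0 ≤ ∑ i, ‖(ω i).1 - (ω i).2‖ ^ 2 - 2 * cyclicSum ω := by
    rw [← sum_cyclic_shift_norm_sq]
    positivity
  unfold cyclicRearrange
  simp only [if_pos h]
  rw [sum_cyclic_shift_nnnorm_sq]
  simp only [nnnorm_sq_eq_ofReal]
  rw [← ENNReal.ofReal_sum_of_nonneg fun _ _ => by positivity]
  exact (ENNReal.ofReal_lt_ofReal_iff_of_nonneg h0).2 (by linarith)

/-- Almost every finite sample of an optimal plan has a nonpositive cyclic sum. -/
lemma IsOptimalPlan.measure_cyclicSum_pos {μ ν : Measure (Rd d)} {π : Measure (Rd d × Rd d)}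
    [IsProbabilityMeasure π] (hπ : IsOptimalPlan π μ ν) (hfin : W2sq μ ν ≠ ⊤) (n : ℕ) :
    Measure.pi (fun _ : Fin (n + 1) => π) {ω | 0 < cyclicSum ω} = 0 := by
  set P := Measure.pi (fun _ : Fin (n + 1) => π)
  by_contra hpos
  have hev : ∀ i : Fin (n + 1), P.map (fun ω => ω i) = π := fun i =>
    (measurePreserving_eval (fun _ : Fin (n + 1) => π) i).map_eq
  let c : ℝ≥0∞ := (((n + 1 : ℕ) : ℝ≥0∞))⁻¹
  have hc : c * (n + 1 : ℕ) = 1 := ENNReal.inv_mul_cancel (by simp) (by simp)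
  let π' : Measure (Rd d × Rd d) := c • ∑ i : Fin (n + 1), P.map (cyclicRearrange i)
  have hlin : ∀ g : Rd d × Rd d → ℝ≥0∞, Measurable g →
      ∫⁻ p, g p ∂π' = c * ∫⁻ ω, ∑ i, g (cyclicRearrange i ω) ∂P := by
    intro g hg
    rw [lintegral_smul_measure, lintegral_finsetSum_measure,
      lintegral_finsetSum (f := fun i ω => g (cyclicRearrange i ω)) _
      fun i _ => hg.comp (measurable_cyclicRearrange i), smul_eq_mul]
    congr 1
    exact Finset.sum_congr rfl fun i _ => lintegral_map hg (measurable_cyclicRearrange i)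
  have hlin' : ∀ g : Rd d × Rd d → ℝ≥0∞, Measurable g →
      ∫⁻ p, g p ∂π = c * ∫⁻ ω, ∑ i, g (ω i) ∂P := by
    intro g hg
    rw [lintegral_finsetSum (f := fun i (ω : Fin (n + 1) → Rd d × Rd d) => g (ω i)) _
      fun i _ => hg.comp (measurable_pi_apply i)]
    have : ∀ i : Fin (n + 1), ∫⁻ ω, g (ω i) ∂P = ∫⁻ p, g p ∂π := fun i => by
      rw [← hev i, lintegral_map hg (measurable_pi_apply i)]
    simp only [this, Finset.sum_const, Finset.card_univ, Fintype.card_fin, nsmul_eq_mul]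
    rw [← mul_assoc, hc, one_mul]
  have hcoup : IsCoupling π' μ ν := by
    rw [← hπ.1.1, ← hπ.1.2]
    constructor
    · ext B hB
      have hg : Measurable fun p : Rd d × Rd d => B.indicator (1 : Rd d → ℝ≥0∞) p.1 :=
        (measurable_one.indicator hB).comp measurable_fst
      have h1 := hlin _ hg
      have h2 := hlin' _ hg
      simp only [sum_comp_cyclicRearrange_fst] at h1
      rw [← h2, ← lintegral_map (measurable_one.indicator hB) measurable_fst,
        ← lintegral_map (measurable_one.indicator hB) measurable_fst,
        lintegral_indicator_one hB, lintegral_indicator_one hB] at h1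
      exact h1
    · ext B hB
      have hg : Measurable fun p : Rd d × Rd d => B.indicator (1 : Rd d → ℝ≥0∞) p.2 :=
        (measurable_one.indicator hB).comp measurable_snd
      have h1 := hlin _ hg
      have h2 := hlin' _ hg
      simp only [cyclicRearrange_snd] at h1
      rw [← h2, ← lintegral_map (measurable_one.indicator hB) measurable_snd,
        ← lintegral_map (measurable_one.indicator hB) measurable_snd,
        lintegral_indicator_one hB, lintegral_indicator_one hB] at h1
      exact h1
  have hgc : Measurable fun p : Rd d × Rd d => (‖p.1 - p.2‖₊ : ℝ≥0∞) ^ 2 := by fun_prop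
  have hle : cost2 π ≤ cost2 π' := hπ.2 ▸ sInf_le ⟨π', hcoup, rfl⟩
  have hc0 : c ≠ 0 := ENNReal.inv_ne_zero.2 (by simp)
  have hct : c ≠ ⊤ := ENNReal.inv_ne_top.2 (by simp)
  have hfin' : cost2 π ≠ ⊤ := hπ.2 ▸ hfin
  rw [cost2, cost2, hlin _ hgc, hlin' _ hgc] at hle
  rw [cost2, hlin' _ hgc] at hfin'
  refine hle.not_gt ((ENNReal.mul_lt_mul_iff_right hc0 hct).2 ?_)
  refine lintegral_strict_mono_of_ae_le_of_ae_lt_on (s := {ω | 0 < cyclicSum ω}) ?_ ?_ ?_ hpos ?_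
  · exact (Finset.measurable_sum _ fun i _ => hgc.comp (measurable_pi_apply i)).aemeasurable
  · intro htop
    have hle' := lintegral_mono (μ := P) fun ω => sum_nnnorm_sq_cyclicRearrange_le (n := n) ω
    rw [htop, top_le_iff] at hle'
    exact hfin' (by rw [hle', ENNReal.mul_top hc0])
  · exact ae_of_all _ fun ω => sum_nnnorm_sq_cyclicRearrange_le ω
  · exact ae_of_all _ fun ω hω => sum_nnnorm_sq_cyclicRearrange_lt hω

/-- The support of an optimal plan is cyclically monotone. -/
lemma IsOptimalPlan.isCyclicallyMonotone_support {μ ν : Measure (Rd d)}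
    {π : Measure (Rd d × Rd d)} [IsProbabilityMeasure π] (hπ : IsOptimalPlan π μ ν)
    (hfin : W2sq μ ν ≠ ⊤) : IsCyclicallyMonotone π.support := by
  intro n f hf
  by_contra! hpos
  have e : ∑ i ∈ Finset.range n, ⟪(f i).2, (f (i + 1)).1 - (f i).1⟫
      + ⟪(f n).2, (f 0).1 - (f n).1⟫ = cyclicSum fun i : Fin (n + 1) => f i := by
    rw [cyclicSum, Fin.sum_univ_castSucc, Finset.sum_range, Fin.last_add_one]
    simp
  rw [e] at hpos
  have hopen : IsOpen {ω : Fin (n + 1) → Rd d × Rd d | 0 < cyclicSum ω} :=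
    isOpen_lt continuous_const continuous_cyclicSum
  obtain ⟨V, hV, hVsub⟩ := isOpen_pi_iff'.1 hopen _ hpos
  have h0 := measure_mono_null hVsub (hπ.measure_cyclicSum_pos hfin n)
  rw [Measure.pi_pi, Finset.prod_eq_zero_iff] at h0
  obtain ⟨i, -, hi⟩ := h0
  exact ((Measure.mem_support_iff_forall _).1 (hf i) _ ((hV i).1.mem_nhds (hV i).2)).ne' hi

lemma memLp_two_iff_lintegral_nnnorm_sq_lt_top {α : Type*} {mα : MeasurableSpace α}
    {m : Measure α} {f : α → Rd d} (hf : AEStronglyMeasurable f m) :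
    MemLp f 2 m ↔ ∫⁻ x, (‖f x‖₊ : ℝ≥0∞) ^ 2 ∂m < ⊤ := by
  rw [MemLp, and_iff_right hf,
    eLpNorm_lt_top_iff_lintegral_rpow_enorm_lt_top two_ne_zero ENNReal.ofNat_ne_top]
  simp [enorm_eq_nnnorm]

lemma lintegral_nnnorm_sq_eq_ofReal {α : Type*} {mα : MeasurableSpace α} {m : Measure α}
    {f : α → Rd d} (hf : MemLp f 2 m) :
    ∫⁻ x, (‖f x‖₊ : ℝ≥0∞) ^ 2 ∂m = ENNReal.ofReal (∫ x, ‖f x‖ ^ 2 ∂m) := by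
  simp only [nnnorm_sq_eq_ofReal]
  rw [ofReal_integral_eq_lintegral_ofReal (integrable_norm_sq_of_memLp hf)
    (ae_of_all _ fun _ => by positivity)]

lemma IsP2.memLp {μ : Measure (Rd d)} (h : IsP2 μ) : MemLp (fun x : Rd d => x) 2 μ :=
  (memLp_two_iff_lintegral_nnnorm_sq_lt_top measurable_id.aestronglyMeasurable).2 h.2

namespace IsCoupling

variable {π : Measure (Rd d × Rd d)} {μ ν : Measure (Rd d)}

lemma measurePreserving_fst (h : IsCoupling π μ ν) : MeasurePreserving Prod.fst π μ :=
  ⟨measurable_fst, h.1⟩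

lemma measurePreserving_snd (h : IsCoupling π μ ν) : MeasurePreserving Prod.snd π ν :=
  ⟨measurable_snd, h.2⟩

lemma isProbabilityMeasure [IsProbabilityMeasure μ] (h : IsCoupling π μ ν) :
    IsProbabilityMeasure π :=
  ⟨by
    have := h.measurePreserving_fst.measure_preimage (s := univ)
      MeasurableSet.univ.nullMeasurableSet
    simpa using this⟩

lemma memLp_sub (h : IsCoupling π μ ν) (hμ : IsP2 μ) (hν : IsP2 ν) :
    MemLp (fun p : Rd d × Rd d => p.1 - p.2) 2 π :=
  (hμ.memLp.comp_measurePreserving h.measurePreserving_fst).sub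
    (hν.memLp.comp_measurePreserving h.measurePreserving_snd)

lemma cost2_eq_ofReal (h : IsCoupling π μ ν) (hμ : IsP2 μ) (hν : IsP2 ν) :
    cost2 π = ENNReal.ofReal (∫ p, ‖p.1 - p.2‖ ^ 2 ∂π) :=
  lintegral_nnnorm_sq_eq_ofReal (h.memLp_sub hμ hν)

lemma swap (h : IsCoupling π μ ν) : IsCoupling (π.map Prod.swap) ν μ := by
  constructor
  · rw [Measure.map_map measurable_fst measurable_swap]
    exact h.2
  · rw [Measure.map_map measurable_snd measurable_swap]
    exact h.1

end IsCoupling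

lemma cost2_map_swap (π : Measure (Rd d × Rd d)) : cost2 (π.map Prod.swap) = cost2 π := by
  rw [cost2, cost2, lintegral_map (by fun_prop) measurable_swap]
  simp only [Prod.fst_swap, Prod.snd_swap, nnnorm_sq_eq_ofReal, norm_sub_rev]

lemma W2sq_comm (μ ν : Measure (Rd d)) : W2sq μ ν = W2sq ν μ := by
  refine le_antisymm ?_ ?_ <;>
  · refine le_sInf ?_
    rintro _ ⟨π, hπ, rfl⟩
    exact sInf_le ⟨_, hπ.swap, (cost2_map_swap π).symm⟩

lemma IsOptimalPlan.swap {π : Measure (Rd d × Rd d)} {μ ν : Measure (Rd d)}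
    (h : IsOptimalPlan π μ ν) : IsOptimalPlan (π.map Prod.swap) ν μ :=
  ⟨h.1.swap, by rw [cost2_map_swap, h.2, W2sq_comm]⟩

lemma W2sq_ne_top {μ ν : Measure (Rd d)} (hμ : IsP2 μ) (hν : IsP2 ν) : W2sq μ ν ≠ ⊤ := by
  have := hμ.1
  have := hν.1
  have hc : IsCoupling (μ.prod ν) μ ν := ⟨by simp, by simp⟩
  refine ne_top_of_le_ne_top ?_ (sInf_le ⟨_, hc, rfl⟩ : W2sq μ ν ≤ _)
  rw [hc.cost2_eq_ofReal hμ hν]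
  exact ENNReal.ofReal_ne_top

lemma IsOptimalPlan.integral_snd_inner_nonpos {π : Measure (Rd d × Rd d)} {μ ν : Measure (Rd d)}
    (hπ : IsOptimalPlan π μ ν) (hμ : IsP2 μ) (hν : IsP2 ν) {w : Rd d → Rd d}
    (hw : MemLp w 2 μ) (hdiv : IsDivFree μ w) : ∫ p, ⟪p.2, w p.1⟫ ∂π ≤ 0 := by
  have := hμ.1
  have := hπ.1.isProbabilityMeasure
  have hwπ : MemLp (fun p : Rd d × Rd d => w p.1) 2 π :=
    hw.comp_measurePreserving hπ.1.measurePreserving_fst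
  have hyπ : MemLp (fun p : Rd d × Rd d => p.2) 2 π :=
    hν.memLp.comp_measurePreserving hπ.1.measurePreserving_snd
  have hi : Integrable (fun p : Rd d × Rd d => ⟪p.2, w p.1⟫) π := integrable_inner_of_memLp hyπ hwπ
  have hi' : Integrable (fun p : Rd d × Rd d => ‖p.2‖ * ‖w p.1‖) π :=
    hyπ.norm.integrable_mul hwπ.norm
  have hwi : Integrable (fun p : Rd d × Rd d => ‖w p.1‖) π := (hwπ.integrable one_le_two).norm
  have key : ∀ n : ℕ, ∫ p, ⟪p.2, w p.1⟫ ∂π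
      ≤ 2 * ∫ p in {p : Rd d × Rd d | n < ‖p.2‖}, ‖p.2‖ * ‖w p.1‖ ∂π := by
    intro n
    set B := {p : Rd d × Rd d | n < ‖p.2‖}
    have hB : MeasurableSet B := measurableSet_lt measurable_const (by fun_prop)
    set A := π.support ∩ Bᶜ
    have hA : MeasurableSet A := Measure.isClosed_support.measurableSet.inter hB.compl
    have hAB : π.restrict Aᶜ = π.restrict B := by
      refine Measure.restrict_congr_set ?_
      filter_upwards [Measure.support_mem_ae (μ := π)] with p hp
      refine propext ⟨fun h => ?_, fun h h' => h'.2 h⟩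
      by_contra hpB
      exact h ⟨hp, hpB⟩
    have h1 : ∫ p in A, ⟪p.2, w p.1⟫ ∂π ≤ ∫ p in B, ‖p.2‖ * ‖w p.1‖ ∂π := by
      have h2 : ∫ p in A, ⟪p.2, w p.1⟫ ∂π ≤ n * ∫ p in Aᶜ, ‖w p.1‖ ∂π := by
        rcases A.eq_empty_or_nonempty with hA0 | hA0
        · rw [hA0, setIntegral_empty]
          exact mul_nonneg (Nat.cast_nonneg _) (integral_nonneg fun _ => norm_nonneg _)
        · have hAK : ∀ p ∈ A, ‖p.2‖ ≤ (n : ℝ≥0) := fun p hp => not_lt.1 hp.2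
          obtain ⟨ψ, hψ, hL, hsub⟩ := ((hπ.isCyclicallyMonotone_support
            (W2sq_ne_top hμ hν)).mono inter_subset_left).exists_convexOn_lipschitzWith hA0 hAK
          exact hdiv.setIntegral_inner_le hμ.memLp hw hπ.1.measurePreserving_fst hψ hL hA hAK hsub
      refine h2.trans ?_
      rw [hAB, ← integral_const_mul]
      refine setIntegral_mono_on (hwi.const_mul _).integrableOn hi'.integrableOn hB fun p hp => ?_
      exact mul_le_mul_of_nonneg_right (le_of_lt hp) (norm_nonneg _)
    have h3 : ∫ p in Aᶜ, ⟪p.2, w p.1⟫ ∂π ≤ ∫ p in B, ‖p.2‖ * ‖w p.1‖ ∂π := by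
      rw [hAB]
      exact integral_mono hi.integrableOn hi'.integrableOn fun p => real_inner_le_norm _ _
    rw [← integral_add_compl hA hi]
    linarith
  have hlim := tendsto_setIntegral_of_antitone (μ := π)
    (s := fun n : ℕ => {p : Rd d × Rd d | (n : ℝ) < ‖p.2‖})
    (f := fun p => ‖p.2‖ * ‖w p.1‖) (fun n => measurableSet_lt measurable_const (by fun_prop))
    (fun n m hnm p hp => lt_of_le_of_lt (Nat.cast_le.2 hnm : (n : ℝ) ≤ m) hp) ⟨0, hi'.integrableOn⟩
  have hempty : ⋂ n : ℕ, {p : Rd d × Rd d | (n : ℝ) < ‖p.2‖} = ∅ := by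
    refine eq_empty_of_forall_notMem fun p hp => ?_
    obtain ⟨n, hn⟩ := exists_nat_ge ‖p.2‖
    exact (mem_iInter.1 hp n).not_ge hn
  rw [hempty, setIntegral_empty] at hlim
  refine ge_of_tendsto' (x := atTop) (by simpa using hlim.const_mul 2) key

lemma IsDivFree.neg {m : Measure (Rd d)} {w : Rd d → Rd d} (h : IsDivFree m w) :
    IsDivFree m fun x => -w x := by
  intro φ hφ hφc
  simp only [map_neg, integral_neg, h φ hφ hφc, neg_zero]

/-- The displacement of an optimal plan is orthogonal to divergence-free fields. -/
lemma IsOptimalPlan.integral_inner_sub_eq_zero {π : Measure (Rd d × Rd d)} {μ ν : Measure (Rd d)}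
    (hπ : IsOptimalPlan π μ ν) (hμ : IsP2 μ) (hν : IsP2 ν) {w : Rd d → Rd d}
    (hw : MemLp w 2 μ) (hdiv : IsDivFree μ w) : ∫ p, ⟪p.1 - p.2, w p.1⟫ ∂π = 0 := by
  have := hμ.1
  have hfst := hπ.1.measurePreserving_fst
  have hwπ : MemLp (fun p : Rd d × Rd d => w p.1) 2 π := hw.comp_measurePreserving hfst
  have hy : ∫ p, ⟪p.2, w p.1⟫ ∂π = 0 := by
    refine le_antisymm (hπ.integral_snd_inner_nonpos hμ hν hw hdiv) ?_
    have := hπ.integral_snd_inner_nonpos hμ hν hw.neg hdiv.neg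
    simp only [Pi.neg_apply, inner_neg_right, integral_neg] at this
    linarith
  have hx : ∫ p, ⟪p.1, w p.1⟫ ∂π = 0 := by
    have hd : ∀ x : Rd d, HasFDerivAt (fun x : Rd d => ‖x‖ ^ 2) (2 • innerSL ℝ x) x := fun x =>
      (hasStrictFDerivAt_norm_sq x).hasFDerivAt
    have h := hdiv.integral_fderiv_eq_zero hμ.memLp hw (f := fun x => ‖x‖ ^ 2)
      (contDiff_norm_sq ℝ) (C := 2) fun x => by
        rw [(hd x).fderiv, two_nsmul, ← two_smul ℝ, norm_smul, innerSL_apply_norm]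
        norm_num
    have e : ∀ x, fderiv ℝ (fun x : Rd d => ‖x‖ ^ 2) x (w x) = 2 * ⟪x, w x⟫ := fun x => by
      rw [(hd x).fderiv]
      simp [two_mul]
    simp only [e, integral_const_mul, mul_eq_zero, two_ne_zero, false_or] at h
    rw [← h, ← hfst.map_eq, integral_map hfst.aemeasurable]
    rw [hfst.map_eq]
    exact (integrable_inner_of_memLp hμ.memLp hw).1
  have hix : Integrable (fun p : Rd d × Rd d => ⟪p.1, w p.1⟫) π :=
    integrable_inner_of_memLp (hμ.memLp.comp_measurePreserving hfst) hwπ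
  have hiy : Integrable (fun p : Rd d × Rd d => ⟪p.2, w p.1⟫) π :=
    integrable_inner_of_memLp (hν.memLp.comp_measurePreserving hπ.1.measurePreserving_snd) hwπ
  simp only [inner_sub_left]
  rw [integral_sub hix hiy, hx, hy, sub_zero]

lemma memLp_gradient {m : Measure (Rd d)} [IsFiniteMeasure m] {φ : Rd d → ℝ}
    (hφ : ContDiff ℝ ((⊤ : ℕ∞) : WithTop ℕ∞) φ) (hφc : HasCompactSupport φ) :
    MemLp (gradient φ) 2 m := by
  have hc : Continuous (gradient φ) :=
    (InnerProductSpace.toDual ℝ (Rd d)).symm.continuous.comp (hφ.continuous_fderiv (by simp))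
  have hs : HasCompactSupport (gradient φ) :=
    (hφc.fderiv ℝ).comp_left (g := (InnerProductSpace.toDual ℝ (Rd d)).symm) (map_zero _)
  exact hc.memLp_of_hasCompactSupport hs

lemma gradient_add_of_contDiff {φ χ : Rd d → ℝ} (hφ : ContDiff ℝ ((⊤ : ℕ∞) : WithTop ℕ∞) φ)
    (hχ : ContDiff ℝ ((⊤ : ℕ∞) : WithTop ℕ∞) χ) :
    gradient (fun x => φ x + χ x) = gradient φ + gradient χ := by
  ext1 x
  simp only [gradient, Pi.add_apply]
  rw [← map_add, ← fderiv_add (hφ.differentiable (by simp) x) (hχ.differentiable (by simp) x)]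
  rfl

lemma gradient_const_mul_of_contDiff (c : ℝ) {φ : Rd d → ℝ}
    (hφ : ContDiff ℝ ((⊤ : ℕ∞) : WithTop ℕ∞) φ) :
    gradient (fun x => c * φ x) = c • gradient φ := by
  ext1 x
  simp only [gradient, Pi.smul_apply]
  rw [fderiv_const_mul (hφ.differentiable (by simp) x)]
  simp

/-- The subspace of gradients of test functions in `L²(m)`. -/
def gradientSubmodule (m : Measure (Rd d)) [IsFiniteMeasure m] : Submodule ℝ (Lp (Rd d) 2 m) where
  carrier := {g | ∃ φ : Rd d → ℝ, ContDiff ℝ ((⊤ : ℕ∞) : WithTop ℕ∞) φ ∧ HasCompactSupport φ ∧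
    g =ᵐ[m] gradient φ}
  add_mem' := by
    rintro g g' ⟨φ, hφ, hφc, h⟩ ⟨χ, hχ, hχc, h'⟩
    refine ⟨fun x => φ x + χ x, hφ.add hχ, hφc.add hχc, ?_⟩
    rw [gradient_add_of_contDiff hφ hχ]
    exact (Lp.coeFn_add g g').trans (h.add h')
  zero_mem' := by
    refine ⟨fun _ => 0, contDiff_const, HasCompactSupport.zero, ?_⟩
    refine (Lp.coeFn_zero _ _ _).trans (ae_of_all _ fun x => ?_)
    simp [gradient]
  smul_mem' := by
    rintro c g ⟨φ, hφ, hφc, h⟩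
    refine ⟨fun x => c * φ x, contDiff_const.mul hφ, hφc.mul_left, ?_⟩
    rw [gradient_const_mul_of_contDiff c hφ]
    exact (Lp.coeFn_smul c g).trans (h.const_smul c)

lemma inner_gradient (φ : Rd d → ℝ) (x y : Rd d) : ⟪gradient φ x, y⟫ = fderiv ℝ φ x y := by
  rw [gradient, InnerProductSpace.toDual_symm_apply]

/-- The action of an optimal displacement on square integrable fields is approximated by that of
gradients of test functions. -/
lemma IsOptimalPlan.exists_gradient_approx {π : Measure (Rd d × Rd d)} {μ ν : Measure (Rd d)}
    (hπ : IsOptimalPlan π μ ν) (hμ : IsP2 μ) (hν : IsP2 ν) {ε : ℝ} (hε : 0 < ε) :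
    ∃ φ : Rd d → ℝ, ContDiff ℝ ((⊤ : ℕ∞) : WithTop ℕ∞) φ ∧ HasCompactSupport φ ∧
      ∀ w : Rd d → Rd d, MemLp w 2 μ →
        |∫ p, ⟪p.1 - p.2, w p.1⟫ ∂π - ∫ x, fderiv ℝ φ x (w x) ∂μ| ≤ ε * √(∫ x, ‖w x‖ ^ 2 ∂μ) := by
  have := hμ.1
  have hfst := hπ.1.measurePreserving_fst
  have hD := hπ.1.memLp_sub hμ hν
  let U : Lp (Rd d) 2 μ →L[ℝ] Lp (Rd d) 2 π :=
    (Lp.compMeasurePreservingₗᵢ ℝ Prod.fst hfst).toContinuousLinearMap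
  let β : Lp (Rd d) 2 μ := U.adjoint hD.toLp
  have hβ : ∀ w : Rd d → Rd d, ∀ hw : MemLp w 2 μ,
      ⟪β, hw.toLp⟫ = ∫ p, ⟪p.1 - p.2, w p.1⟫ ∂π := by
    intro w hw
    rw [ContinuousLinearMap.adjoint_inner_left]
    have : U hw.toLp = (hw.comp_measurePreserving hfst).toLp :=
      Lp.toLp_compMeasurePreserving hw hfst
    rw [this, inner_toLp]
    rfl
  have hmem : β ∈ (gradientSubmodule μ).topologicalClosure := by
    rw [← Submodule.orthogonal_orthogonal_eq_closure, Submodule.mem_orthogonal']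
    intro g hg
    have hgm : MemLp g 2 μ := Lp.memLp g
    have hg' : g = hgm.toLp := (Lp.toLp_coeFn g _).symm
    rw [hg', hβ, hπ.integral_inner_sub_eq_zero hμ hν hgm]
    intro φ hφ hφc
    have hφL : MemLp (gradient φ) 2 μ := memLp_gradient hφ hφc
    have h := (Submodule.mem_orthogonal _ _).1 hg hφL.toLp ⟨φ, hφ, hφc, hφL.coeFn_toLp⟩
    rw [hg', inner_toLp hφL hgm] at h
    simpa only [inner_gradient] using h
  obtain ⟨g, ⟨φ, hφ, hφc, hg⟩, hgβ⟩ := Metric.mem_closure_iff.1 hmem ε hε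
  refine ⟨φ, hφ, hφc, fun w hw => ?_⟩
  have hφL : MemLp (gradient φ) 2 μ := memLp_gradient hφ hφc
  have hg' : g = hφL.toLp := Lp.ext (hg.trans hφL.coeFn_toLp.symm)
  have e : ∫ x, fderiv ℝ φ x (w x) ∂μ = ⟪g, hw.toLp⟫ := by
    rw [hg', inner_toLp hφL hw]
    simp only [inner_gradient]
  rw [← hβ w hw, e, ← inner_sub_left, ← norm_toLp_eq_sqrt hw]
  refine (abs_real_inner_le_norm _ _).trans ?_
  rw [← dist_eq_norm]
  gcongr

section Displacement

open ProbabilityTheory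

variable {m : Measure (Rd d)} {κ : Kernel (Rd d) (Rd d)}

/-- The mean displacement of a Markov kernel on `ℝ^d`. -/
def meanDisplacement (κ : Kernel (Rd d) (Rd d)) (x : Rd d) : Rd d :=
  ∫ z, (z - x) ∂κ x

variable [IsMarkovKernel κ]

lemma measurable_meanDisplacement : Measurable (meanDisplacement κ) :=
  (StronglyMeasurable.integral_kernel_prod_right' (κ := κ)
    (f := fun p : Rd d × Rd d => p.2 - p.1) (by fun_prop)).measurable

lemma nnnorm_meanDisplacement_sq_le (x : Rd d) :
    (‖meanDisplacement κ x‖₊ : ℝ≥0∞) ^ 2 ≤ ∫⁻ z, (‖z - x‖₊ : ℝ≥0∞) ^ 2 ∂κ x := by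
  have h1 : ‖meanDisplacement κ x‖ₑ ≤ eLpNorm (fun z => z - x) 1 (κ x) := by
    rw [eLpNorm_one_eq_lintegral_enorm]
    exact enorm_integral_le_lintegral_enorm _
  have h2 := h1.trans (eLpNorm_le_eLpNorm_of_exponent_le (one_le_two)
    (measurable_id.sub_const x).aestronglyMeasurable)
  rw [eLpNorm_eq_lintegral_rpow_enorm_toReal two_ne_zero ENNReal.ofNat_ne_top] at h2
  have h3 := ENNReal.rpow_le_rpow h2 zero_le_two
  rw [← ENNReal.rpow_mul] at h3
  simpa [enorm_eq_nnnorm] using h3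

variable [IsProbabilityMeasure m]

lemma memLp_meanDisplacement (h : MemLp (fun p : Rd d × Rd d => p.2 - p.1) 2 (m ⊗ₘ κ)) :
    MemLp (meanDisplacement κ) 2 m ∧
      ∫ x, ‖meanDisplacement κ x‖ ^ 2 ∂m ≤ ∫ p, ‖p.2 - p.1‖ ^ 2 ∂(m ⊗ₘ κ) := by
  have hle : ∫⁻ x, (‖meanDisplacement κ x‖₊ : ℝ≥0∞) ^ 2 ∂m
      ≤ ∫⁻ p, (‖p.2 - p.1‖₊ : ℝ≥0∞) ^ 2 ∂(m ⊗ₘ κ) := by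
    rw [Measure.lintegral_compProd (by fun_prop)]
    exact lintegral_mono fun x => nnnorm_meanDisplacement_sq_le x
  have hL : MemLp (meanDisplacement κ) 2 m :=
    (memLp_two_iff_lintegral_nnnorm_sq_lt_top
      measurable_meanDisplacement.aestronglyMeasurable).2
      (hle.trans_lt ((memLp_two_iff_lintegral_nnnorm_sq_lt_top h.1).1 h))
  refine ⟨hL, ?_⟩
  rw [lintegral_nnnorm_sq_eq_ofReal hL, lintegral_nnnorm_sq_eq_ofReal h] at hle
  exact (ENNReal.ofReal_le_ofReal_iff (integral_nonneg fun _ => by positivity)).1 hle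

variable {Z W : Type*} {mZ : MeasurableSpace Z} {mW : MeasurableSpace W} {π : Measure Z}
  [IsProbabilityMeasure π] {K : Kernel Z W} [IsMarkovKernel K] {f : Z → Rd d} {g : W → Rd d}

lemma measurePreserving_compProd (hf : MeasurePreserving f π m) (hg : Measurable g)
    (hK : ∀ z, (K z).map g = κ (f z)) :
    MeasurePreserving (fun q : Z × W => (f q.1, g q.2)) (π ⊗ₘ K) (m ⊗ₘ κ) := by
  have hfm := hf.measurable
  have hmeas : Measurable fun q : Z × W => (f q.1, g q.2) := by fun_prop
  refine ⟨hmeas, ?_⟩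
  ext B hB
  rw [Measure.map_apply hmeas hB, Measure.compProd_apply (hmeas hB), Measure.compProd_apply hB,
    ← hf.map_eq, lintegral_map (Kernel.measurable_kernel_prodMk_left hB) hfm]
  refine lintegral_congr fun z => ?_
  rw [← hK, Measure.map_apply hg (measurable_prodMk_left hB)]
  rfl

lemma integral_inner_compProd (hf : MeasurePreserving f π m) (hg : Measurable g)
    (hK : ∀ z, (K z).map g = κ (f z))
    (h : MemLp (fun p : Rd d × Rd d => p.2 - p.1) 2 (m ⊗ₘ κ)) {D : Z → Rd d} (hD : MemLp D 2 π) :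
    ∫ q, ⟪D q.1, g q.2 - f q.1⟫ ∂(π ⊗ₘ K) = ∫ z, ⟪D z, meanDisplacement κ (f z)⟫ ∂π := by
  have hfst : MeasurePreserving Prod.fst (π ⊗ₘ K) π :=
    ⟨measurable_fst, Measure.fst_compProd π K⟩
  have hgf : MemLp (fun q : Z × W => g q.2 - f q.1) 2 (π ⊗ₘ K) :=
    h.comp_measurePreserving (measurePreserving_compProd hf hg hK)
  have hi : Integrable (fun q : Z × W => ⟪D q.1, g q.2 - f q.1⟫) (π ⊗ₘ K) :=
    integrable_inner_of_memLp (hD.comp_measurePreserving hfst) hgf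
  rw [Measure.integral_compProd hi]
  have hae := (Measure.integrable_compProd_iff (hgf.1)).1 (hgf.integrable one_le_two)
  refine integral_congr_ae ?_
  filter_upwards [hae.1] with z hz
  rw [integral_inner hz, meanDisplacement, ← hK, integral_map hg.aemeasurable
    (by fun_prop)]

end Displacement

lemma exists_abs_sub_sub_fderiv_le {φ : Rd d → ℝ} (hφ : ContDiff ℝ ((⊤ : ℕ∞) : WithTop ℕ∞) φ)
    (hφc : HasCompactSupport φ) :
    ∃ C : ℝ, 0 ≤ C ∧ ∀ x x', |φ x' - φ x - fderiv ℝ φ x (x' - x)| ≤ C * ‖x' - x‖ ^ 2 := by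
  obtain ⟨C, hC⟩ := ContDiff.lipschitzWith_of_hasCompactSupport (𝕂 := ℝ) (hφc.fderiv ℝ)
    ((hφ.fderiv_right (m := ((⊤ : ℕ∞) : WithTop ℕ∞)) (by simp)).of_le
      (by exact_mod_cast le_top) : ContDiff ℝ 1 _) one_ne_zero
  refine ⟨C, C.2, fun x x' => ?_⟩
  have h := (convex_segment x x').norm_image_sub_le_of_norm_fderiv_le' (𝕜 := ℝ) (f := φ)
    (φ := fderiv ℝ φ x) (C := C * ‖x' - x‖) (fun z _ => hφ.differentiable (by simp) z)
    (fun z hz => ?_) (left_mem_segment ℝ x x') (right_mem_segment ℝ x x')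
  · rw [Real.norm_eq_abs] at h
    exact h.trans (le_of_eq (by ring))
  · rw [← dist_eq_norm]
    refine (hC.dist_le_mul z x).trans ?_
    gcongr
    rw [dist_eq_norm]
    exact norm_sub_le_of_mem_segment hz

lemma IsCoupling.compProd_condKernel {γ : Measure (Rd d × Rd d)} {μ μ' : Measure (Rd d)}
    [IsFiniteMeasure γ] (hγ : IsCoupling γ μ μ') : μ.compProd γ.condKernel = γ := by
  have h : γ.fst = μ := hγ.1
  rw [← h]
  exact γ.disintegrate γ.condKernel

lemma IsCoupling.memLp_sub' {γ : Measure (Rd d × Rd d)} {μ μ' : Measure (Rd d)}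
    (hγ : IsCoupling γ μ μ') (hμ : IsP2 μ) (hμ' : IsP2 μ') :
    MemLp (fun p : Rd d × Rd d => p.2 - p.1) 2 γ := by
  have e : (fun p : Rd d × Rd d => p.2 - p.1) = -fun p => p.1 - p.2 := by ext; simp
  rw [e]
  exact (hγ.memLp_sub hμ hμ').neg

lemma IsCoupling.memLp_meanDisplacement {γ : Measure (Rd d × Rd d)} {μ μ' : Measure (Rd d)}
    [IsFiniteMeasure γ] (hγ : IsCoupling γ μ μ') (hμ : IsP2 μ) (hμ' : IsP2 μ') :
    MemLp (meanDisplacement γ.condKernel) 2 μ ∧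
      ∫ x, ‖meanDisplacement γ.condKernel x‖ ^ 2 ∂μ ≤ ∫ p, ‖p.1 - p.2‖ ^ 2 ∂γ := by
  have := hμ.1
  have h := MSP.memLp_meanDisplacement (m := μ) (κ := γ.condKernel)
    (by rw [hγ.compProd_condKernel]; exact hγ.memLp_sub' hμ hμ')
  rw [hγ.compProd_condKernel] at h
  simpa only [norm_sub_rev] using h

lemma IsP2.integrable_of_hasCompactSupport {μ : Measure (Rd d)} (hμ : IsP2 μ) {φ : Rd d → ℝ}
    (hφ : Continuous φ) (hφc : HasCompactSupport φ) : Integrable φ μ := by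
  have := hμ.1
  exact hφ.integrable_of_hasCompactSupport hφc

lemma IsCoupling.integral_fst {γ : Measure (Rd d × Rd d)} {μ μ' : Measure (Rd d)}
    (hγ : IsCoupling γ μ μ') {φ : Rd d → ℝ} (hφ : Continuous φ) :
    ∫ p, φ p.1 ∂γ = ∫ x, φ x ∂μ := by
  rw [← hγ.1, integral_map (by fun_prop) (by fun_prop)]

lemma IsCoupling.integral_snd {γ : Measure (Rd d × Rd d)} {μ μ' : Measure (Rd d)}
    (hγ : IsCoupling γ μ μ') {φ : Rd d → ℝ} (hφ : Continuous φ) :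
    ∫ p, φ p.2 ∂γ = ∫ x, φ x ∂μ' := by
  rw [← hγ.2, integral_map (by fun_prop) (by fun_prop)]

lemma IsCoupling.abs_integral_fderiv_meanDisplacement_sub_le {γ : Measure (Rd d × Rd d)}
    {μ μ' : Measure (Rd d)} [IsFiniteMeasure γ] (hγ : IsCoupling γ μ μ') (hμ : IsP2 μ)
    (hμ' : IsP2 μ') {φ : Rd d → ℝ} (hφ : ContDiff ℝ ((⊤ : ℕ∞) : WithTop ℕ∞) φ)
    (hφc : HasCompactSupport φ) {C : ℝ}
    (hC : ∀ x x', |φ x' - φ x - fderiv ℝ φ x (x' - x)| ≤ C * ‖x' - x‖ ^ 2) :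
    |∫ x, fderiv ℝ φ x (meanDisplacement γ.condKernel x) ∂μ - (∫ x, φ x ∂μ' - ∫ x, φ x ∂μ)|
      ≤ C * ∫ p, ‖p.1 - p.2‖ ^ 2 ∂γ := by
  have := hμ.1
  have hsub := hγ.memLp_sub' hμ hμ'
  have hg : MemLp (gradient φ) 2 μ := memLp_gradient hφ hφc
  have h := integral_inner_compProd (m := μ) (κ := γ.condKernel) (π := μ) (K := γ.condKernel)
    (f := id) (g := id) (MeasurePreserving.id μ) measurable_id (fun z => Measure.map_id)
    (by rw [hγ.compProd_condKernel]; exact hsub) hg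
  rw [hγ.compProd_condKernel] at h
  simp only [inner_gradient, id] at h
  have hi : Integrable (fun p : Rd d × Rd d => fderiv ℝ φ p.1 (p.2 - p.1)) γ := by
    simpa only [inner_gradient, Function.comp_apply] using integrable_inner_of_memLp
      (hg.comp_measurePreserving hγ.measurePreserving_fst) hsub
  have h1 : Integrable (fun p : Rd d × Rd d => φ p.1) γ :=
    hγ.measurePreserving_fst.integrable_comp_of_integrable
      (hμ.integrable_of_hasCompactSupport hφ.continuous hφc)
  have h2 : Integrable (fun p : Rd d × Rd d => φ p.2) γ :=
    hγ.measurePreserving_snd.integrable_comp_of_integrable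
      (hμ'.integrable_of_hasCompactSupport hφ.continuous hφc)
  have h21 : Integrable (fun p : Rd d × Rd d => φ p.2 - φ p.1) γ := h2.sub h1
  rw [← h, ← hγ.integral_fst hφ.continuous, ← hγ.integral_snd hφ.continuous,
    ← integral_sub h2 h1, ← integral_sub hi h21, ← integral_const_mul, ← Real.norm_eq_abs]
  refine norm_integral_le_of_norm_le ((integrable_norm_sq_of_memLp
    (hγ.memLp_sub hμ hμ')).const_mul C) (ae_of_all _ fun p => ?_)
  rw [norm_sub_rev, Real.norm_eq_abs, norm_sub_rev p.1]
  exact hC _ _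

open ProbabilityTheory in
/-- Gluing of couplings of both marginals of a plan. -/
lemma IsCoupling.exists_gluing {π γ η : Measure (Rd d × Rd d)} {μ ν μ' ν' : Measure (Rd d)}
    (hπ : IsCoupling π μ ν) (hμ : IsP2 μ) (hν : IsP2 ν) (hμ' : IsP2 μ') (hν' : IsP2 ν')
    (hγ : IsCoupling γ μ μ') (hη : IsCoupling η ν ν') [IsFiniteMeasure γ] [IsFiniteMeasure η] :
    ∃ σ : Measure ((Rd d × Rd d) × (Rd d × Rd d)), MeasurePreserving Prod.fst σ π ∧
      MeasurePreserving (fun q => (q.1.1, q.2.1)) σ γ ∧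
      MeasurePreserving (fun q => (q.1.2, q.2.2)) σ η ∧
      IsCoupling (σ.map Prod.snd) μ' ν' ∧
      ∫ q, ⟪q.1.1 - q.1.2, q.2.1 - q.1.1⟫ ∂σ
        = ∫ p, ⟪p.1 - p.2, meanDisplacement γ.condKernel p.1⟫ ∂π ∧
      ∫ q, ⟪q.1.2 - q.1.1, q.2.2 - q.1.2⟫ ∂σ
        = ∫ p, ⟪p.2 - p.1, meanDisplacement η.condKernel p.2⟫ ∂π := by
  have := hμ.1
  have := hν.1
  have := hπ.isProbabilityMeasure
  let K : Kernel (Rd d × Rd d) (Rd d × Rd d) :=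
    (γ.condKernel.comap Prod.fst measurable_fst) ×ₖ (η.condKernel.comap Prod.snd measurable_snd)
  have hK : ∀ z, K z = (γ.condKernel z.1).prod (η.condKernel z.2) := fun z => by
    simp only [K, Kernel.prod_apply, Kernel.comap_apply]
  have hK1 : ∀ z, (K z).map Prod.fst = γ.condKernel z.1 := fun z => by
    rw [hK, Measure.map_fst_prod, measure_univ, one_smul]
  have hK2 : ∀ z, (K z).map Prod.snd = η.condKernel z.2 := fun z => by
    rw [hK, Measure.map_snd_prod, measure_univ, one_smul]
  let σ := π ⊗ₘ K
  have hσγ : MeasurePreserving (fun q : (Rd d × Rd d) × (Rd d × Rd d) => (q.1.1, q.2.1)) σ γ := by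
    have := measurePreserving_compProd hπ.measurePreserving_fst measurable_fst hK1
    rwa [hγ.compProd_condKernel] at this
  have hση : MeasurePreserving (fun q : (Rd d × Rd d) × (Rd d × Rd d) => (q.1.2, q.2.2)) σ η := by
    have := measurePreserving_compProd hπ.measurePreserving_snd measurable_snd hK2
    rwa [hη.compProd_condKernel] at this
  refine ⟨σ, ⟨measurable_fst, Measure.fst_compProd π K⟩, hσγ, hση, ⟨?_, ?_⟩, ?_, ?_⟩
  · rw [Measure.map_map measurable_fst measurable_snd]
    exact (hγ.measurePreserving_snd.comp hσγ).map_eq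
  · rw [Measure.map_map measurable_snd measurable_snd]
    exact (hη.measurePreserving_snd.comp hση).map_eq
  · exact integral_inner_compProd hπ.measurePreserving_fst measurable_fst hK1
      (by rw [hγ.compProd_condKernel]; exact hγ.memLp_sub' hμ hμ') (hπ.memLp_sub hμ hν)
  · exact integral_inner_compProd hπ.measurePreserving_snd measurable_snd hK2
      (by rw [hη.compProd_condKernel]; exact hη.memLp_sub' hν hν') (hπ.memLp_sub' hμ hν)

lemma integral_norm_sq_sub_of_measurePreserving {σ : Measure ((Rd d × Rd d) × (Rd d × Rd d))}
    {τ : Measure (Rd d × Rd d)} {f : (Rd d × Rd d) × (Rd d × Rd d) → Rd d × Rd d}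
    (hf : MeasurePreserving f σ τ) :
    ∫ q, ‖(f q).1 - (f q).2‖ ^ 2 ∂σ = ∫ p, ‖p.1 - p.2‖ ^ 2 ∂τ := by
  rw [← hf.map_eq, integral_map hf.aemeasurable (by fun_prop)]

lemma IsCoupling.W2sq_toReal_le {γ : Measure (Rd d × Rd d)} {μ μ' : Measure (Rd d)}
    (hγ : IsCoupling γ μ μ') (hμ : IsP2 μ) (hμ' : IsP2 μ') :
    (W2sq μ μ').toReal ≤ ∫ p, ‖p.1 - p.2‖ ^ 2 ∂γ := by
  have h : W2sq μ μ' ≤ cost2 γ := sInf_le ⟨_, hγ, rfl⟩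
  rw [hγ.cost2_eq_ofReal hμ hμ'] at h
  exact ENNReal.toReal_le_of_le_ofReal (integral_nonneg fun _ => by positivity) h

/-- The cost between perturbed marginals, in terms of the mean displacements. -/
lemma IsOptimalPlan.W2sq_toReal_le {π γ η : Measure (Rd d × Rd d)} {μ ν μ' ν' : Measure (Rd d)}
    (hπ : IsOptimalPlan π μ ν) (hμ : IsP2 μ) (hν : IsP2 ν) (hμ' : IsP2 μ') (hν' : IsP2 ν')
    [IsFiniteMeasure γ] [IsFiniteMeasure η] (hγ : IsCoupling γ μ μ') (hη : IsCoupling η ν ν') :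
    (W2sq μ' ν').toReal ≤ (W2sq μ ν).toReal
      + 2 * ∫ p, ⟪p.1 - p.2, meanDisplacement γ.condKernel p.1⟫ ∂π
      + 2 * ∫ p, ⟪p.2 - p.1, meanDisplacement η.condKernel p.2⟫ ∂π
      + 2 * ∫ p, ‖p.1 - p.2‖ ^ 2 ∂γ + 2 * ∫ p, ‖p.1 - p.2‖ ^ 2 ∂η := by
  obtain ⟨σ, hσπ, hσγ, hση, hcoup, e1, e2⟩ := hπ.1.exists_gluing hμ hν hμ' hν' hγ hη
  have hσ2 : MeasurePreserving Prod.snd σ (σ.map Prod.snd) := measurable_snd.measurePreserving _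
  have hle := hcoup.W2sq_toReal_le hμ' hν'
  rw [← integral_norm_sq_sub_of_measurePreserving hσ2] at hle
  have hπW : (W2sq μ ν).toReal = ∫ p, ‖p.1 - p.2‖ ^ 2 ∂π := by
    rw [← hπ.2, hπ.1.cost2_eq_ofReal hμ hν,
      ENNReal.toReal_ofReal (integral_nonneg fun _ => by positivity)]
  have hD1 := hπ.1.memLp_sub hμ hν
  have hD2 := hπ.1.memLp_sub' hμ hν
  have hγL : MemLp (fun q : (Rd d × Rd d) × (Rd d × Rd d) => q.2.1 - q.1.1) 2 σ :=
    (hγ.memLp_sub' hμ hμ').comp_measurePreserving hσγ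
  have hηL : MemLp (fun q : (Rd d × Rd d) × (Rd d × Rd d) => q.2.2 - q.1.2) 2 σ :=
    (hη.memLp_sub' hν hν').comp_measurePreserving hση
  have hD1L : MemLp (fun q : (Rd d × Rd d) × (Rd d × Rd d) => q.1.1 - q.1.2) 2 σ :=
    hD1.comp_measurePreserving hσπ
  have hD2L : MemLp (fun q : (Rd d × Rd d) × (Rd d × Rd d) => q.1.2 - q.1.1) 2 σ :=
    hD2.comp_measurePreserving hσπ
  have i0 := integrable_norm_sq_of_memLp hD1L
  have i1 := (integrable_inner_of_memLp hD1L hγL).const_mul 2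
  have i2 := (integrable_inner_of_memLp hD2L hηL).const_mul 2
  have i3 := (integrable_norm_sq_of_memLp
    ((hγ.memLp_sub hμ hμ').comp_measurePreserving hσγ)).const_mul 2
  have i4 := (integrable_norm_sq_of_memLp
    ((hη.memLp_sub hν hν').comp_measurePreserving hση)).const_mul 2
  have hpt : ∀ q : (Rd d × Rd d) × (Rd d × Rd d), ‖q.2.1 - q.2.2‖ ^ 2 ≤
      ‖q.1.1 - q.1.2‖ ^ 2 + 2 * ⟪q.1.1 - q.1.2, q.2.1 - q.1.1⟫ + 2 * ⟪q.1.2 - q.1.1, q.2.2 - q.1.2⟫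
        + 2 * ‖q.1.1 - q.2.1‖ ^ 2 + 2 * ‖q.1.2 - q.2.2‖ ^ 2 := by
    rintro ⟨⟨x, y⟩, ⟨x', y'⟩⟩
    simp only
    have h0 : x' - y' = (x - y) + ((x' - x) - (y' - y)) := by abel
    have h1 : y - x = -(x - y) := by abel
    have h2 := parallelogram_law_with_norm ℝ (x' - x) (y' - y)
    rw [h0, norm_add_sq_real, h1, inner_neg_left, inner_sub_right, norm_sub_rev x x',
      norm_sub_rev y y']
    nlinarith [mul_self_nonneg ‖x' - x + (y' - y)‖]
  refine hle.trans ?_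
  have hi' := hcoup.memLp_sub hμ' hν' |>.comp_measurePreserving hσ2
  refine (integral_mono (integrable_norm_sq_of_memLp hi')
    ((((i0.add i1).add i2).add i3).add i4) hpt).trans (le_of_eq ?_)
  rw [integral_add' (((i0.add i1).add i2).add i3) i4, integral_add' ((i0.add i1).add i2) i3,
    integral_add' (i0.add i1) i2, integral_add' i0 i1, integral_const_mul, integral_const_mul,
    integral_const_mul, integral_const_mul, hπW, ← e1, ← e2,
    ← integral_norm_sq_sub_of_measurePreserving hσγ,
    ← integral_norm_sq_sub_of_measurePreserving hση,
    ← integral_norm_sq_sub_of_measurePreserving hσπ]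
  rfl

lemma W2_nonneg (μ ν : Measure (Rd d)) : 0 ≤ W2 μ ν := Real.sqrt_nonneg _

lemma W2_sq (μ ν : Measure (Rd d)) : W2 μ ν ^ 2 = (W2sq μ ν).toReal :=
  Real.sq_sqrt ENNReal.toReal_nonneg

lemma W2_comm (μ ν : Measure (Rd d)) : W2 μ ν = W2 ν μ := by rw [W2, W2sq_comm, W2]

lemma exists_isCoupling_integral_le {μ ν : Measure (Rd d)} (hμ : IsP2 μ) (hν : IsP2 ν) {δ : ℝ}
    (hδ : 0 < δ) :
    ∃ γ, IsCoupling γ μ ν ∧ ∫ p, ‖p.1 - p.2‖ ^ 2 ∂γ ≤ W2 μ ν ^ 2 + δ := by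
  have hlt : W2sq μ ν < W2sq μ ν + ENNReal.ofReal δ :=
    ENNReal.lt_add_right (W2sq_ne_top hμ hν) (by simpa using hδ)
  obtain ⟨_, ⟨γ, hγ, rfl⟩, h⟩ := sInf_lt_iff.1 hlt
  refine ⟨γ, hγ, ?_⟩
  rw [hγ.cost2_eq_ofReal hμ hν, ← ENNReal.ofReal_toReal (W2sq_ne_top hμ hν), ← W2_sq,
    ← ENNReal.ofReal_add (by positivity) hδ.le] at h
  exact (ENNReal.ofReal_lt_ofReal_iff'.1 h).1.le

lemma tendsto_sqrt_sq_add (a : ℝ) (ha : 0 ≤ a) :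
    Tendsto (fun δ : ℝ => √(a ^ 2 + δ)) (𝓝[>] 0) (𝓝 a) := by
  have h : Continuous fun δ : ℝ => √(a ^ 2 + δ) := by fun_prop
  have := h.tendsto 0
  rw [add_zero, Real.sqrt_sq ha] at this
  exact this.mono_left nhdsWithin_le_nhds

lemma W2_le_add_add {μ ν μ' ν' : Measure (Rd d)} (hμ : IsP2 μ) (hν : IsP2 ν) (hμ' : IsP2 μ')
    (hν' : IsP2 ν') : W2 μ' ν' ≤ W2 μ μ' + W2 μ ν + W2 ν ν' := by
  have := hμ.1
  have := hν.1
  have hlim := ((tendsto_sqrt_sq_add _ (W2_nonneg μ μ')).add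
    (tendsto_sqrt_sq_add _ (W2_nonneg μ ν))).add (tendsto_sqrt_sq_add _ (W2_nonneg ν ν'))
  refine ge_of_tendsto hlim (eventually_mem_nhdsWithin.mono fun δ (hδ : 0 < δ) => ?_)
  obtain ⟨π, hπ, hπc⟩ := exists_isCoupling_integral_le hμ hν hδ
  obtain ⟨γ, hγ, hγc⟩ := exists_isCoupling_integral_le hμ hμ' hδ
  obtain ⟨η, hη, hηc⟩ := exists_isCoupling_integral_le hν hν' hδ
  have := hγ.isProbabilityMeasure
  have := hη.isProbabilityMeasure
  obtain ⟨σ, hσπ, hσγ, hση, hcoup, -, -⟩ := hπ.exists_gluing hμ hν hμ' hν' hγ hη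
  have hσ2 : MeasurePreserving Prod.snd σ (σ.map Prod.snd) := measurable_snd.measurePreserving _
  have hle := hcoup.W2sq_toReal_le hμ' hν'
  rw [← integral_norm_sq_sub_of_measurePreserving hσ2] at hle
  rw [← integral_norm_sq_sub_of_measurePreserving hσγ] at hγc
  rw [← integral_norm_sq_sub_of_measurePreserving hση] at hηc
  rw [← integral_norm_sq_sub_of_measurePreserving hσπ] at hπc
  have L1 := (hγ.memLp_sub' hμ hμ').comp_measurePreserving hσγ
  have L2 := (hπ.memLp_sub hμ hν).comp_measurePreserving hσπ
  have L3 := (hη.memLp_sub hν hν').comp_measurePreserving hση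
  have m1 := sqrt_integral_norm_add_sq_le L1 L2
  have m2 := sqrt_integral_norm_add_sq_le (L1.add L2) L3
  simp only [Function.comp_apply, Pi.add_apply, sub_add_sub_cancel] at m1 m2
  rw [W2]
  refine (Real.sqrt_le_sqrt hle).trans (m2.trans ?_)
  refine add_le_add (m1.trans (add_le_add ?_ ?_)) ?_ <;> apply Real.sqrt_le_sqrt
  · simpa only [norm_sub_rev] using hγc
  · exact hπc
  · exact hηc

lemma abs_W2_sub_W2_le {μ ν μ' ν' : Measure (Rd d)} (hμ : IsP2 μ) (hν : IsP2 ν) (hμ' : IsP2 μ')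
    (hν' : IsP2 ν') : |W2 μ' ν' - W2 μ ν| ≤ W2 μ μ' + W2 ν ν' := by
  have h1 := W2_le_add_add hμ hν hμ' hν'
  have h2 := W2_le_add_add hμ' hν' hμ hν
  rw [W2_comm μ' μ, W2_comm ν' ν] at h2
  rw [abs_le]
  constructor <;> linarith

/-- Integrals of Lipschitz functions are Lipschitz for the Wasserstein distance. -/
lemma abs_integral_sub_integral_le {μ μ' : Measure (Rd d)} (hμ : IsP2 μ) (hμ' : IsP2 μ')
    {f : Rd d → ℝ} {L : ℝ} (hL : 0 ≤ L) (hf : Continuous f)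
    (hfL : ∀ x y, |f x - f y| ≤ L * ‖x - y‖) (hi : Integrable f μ) (hi' : Integrable f μ') :
    |∫ x, f x ∂μ' - ∫ x, f x ∂μ| ≤ L * W2 μ μ' := by
  have := hμ.1
  refine ge_of_tendsto ((tendsto_sqrt_sq_add _ (W2_nonneg μ μ')).const_mul L)
    (eventually_mem_nhdsWithin.mono fun δ (hδ : 0 < δ) => ?_)
  obtain ⟨γ, hγ, hγc⟩ := exists_isCoupling_integral_le hμ hμ' hδ
  have := hγ.isProbabilityMeasure
  have hD := hγ.memLp_sub hμ hμ'
  have h1 : Integrable (fun p : Rd d × Rd d => f p.1) γ :=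
    hγ.measurePreserving_fst.integrable_comp_of_integrable hi
  have h2 : Integrable (fun p : Rd d × Rd d => f p.2) γ :=
    hγ.measurePreserving_snd.integrable_comp_of_integrable hi'
  have hDn : Integrable (fun p : Rd d × Rd d => ‖p.1 - p.2‖) γ :=
    (hD.integrable one_le_two).norm
  rw [← hγ.integral_fst hf, ← hγ.integral_snd hf, ← integral_sub h2 h1, ← Real.norm_eq_abs]
  refine (norm_integral_le_of_norm_le (hDn.const_mul L) (ae_of_all _ fun p => ?_)).trans ?_
  · rw [norm_sub_rev]
    exact hfL _ _
  rw [integral_const_mul]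
  gcongr
  refine le_trans ?_ (Real.sqrt_le_sqrt hγc)
  have h := abs_integral_inner_le (m := γ) hD.norm (memLp_const (1 : ℝ))
  simp only [RCLike.inner_apply, conj_trivial, one_mul, norm_norm, norm_one, one_pow,
    integral_const, probReal_univ, smul_eq_mul, mul_one, Real.sqrt_one] at h
  exact (le_abs_self _).trans h

/-- First order expansion from above of the squared Wasserstein distance. -/
lemma IsOptimalPlan.exists_W2_sq_le {π : Measure (Rd d × Rd d)} {μ ν : Measure (Rd d)}
    (hπ : IsOptimalPlan π μ ν) (hμ : IsP2 μ) (hν : IsP2 ν) {ε : ℝ} (hε : 0 < ε) :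
    ∃ φ χ : Rd d → ℝ, ∃ C : ℝ, ContDiff ℝ ((⊤ : ℕ∞) : WithTop ℕ∞) φ ∧ HasCompactSupport φ ∧
      ContDiff ℝ ((⊤ : ℕ∞) : WithTop ℕ∞) χ ∧ HasCompactSupport χ ∧
      (∀ w : Rd d → Rd d, MemLp w 2 μ →
        |∫ p, ⟪p.1 - p.2, w p.1⟫ ∂π - ∫ x, fderiv ℝ φ x (w x) ∂μ| ≤ ε * √(∫ x, ‖w x‖ ^ 2 ∂μ)) ∧
      (∀ w : Rd d → Rd d, MemLp w 2 ν →
        |∫ p, ⟪p.2 - p.1, w p.2⟫ ∂π - ∫ x, fderiv ℝ χ x (w x) ∂ν| ≤ ε * √(∫ x, ‖w x‖ ^ 2 ∂ν)) ∧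
      ∀ μ' ν' : Measure (Rd d), IsP2 μ' → IsP2 ν' →
        W2 μ' ν' ^ 2 ≤ W2 μ ν ^ 2 + 2 * (∫ x, φ x ∂μ' - ∫ x, φ x ∂μ)
          + 2 * (∫ x, χ x ∂ν' - ∫ x, χ x ∂ν) + 2 * ε * (W2 μ μ' + W2 ν ν')
          + C * (W2 μ μ' ^ 2 + W2 ν ν' ^ 2) := by
  have := hμ.1
  have := hν.1
  obtain ⟨φ, hφ, hφc, h1⟩ := hπ.exists_gradient_approx hμ hν hε
  obtain ⟨χ, hχ, hχc, h2⟩ := hπ.swap.exists_gradient_approx hν hμ hε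
  obtain ⟨Cφ, hCφ, hTφ⟩ := exists_abs_sub_sub_fderiv_le hφ hφc
  obtain ⟨Cχ, hCχ, hTχ⟩ := exists_abs_sub_sub_fderiv_le hχ hχc
  have h2' : ∀ w : Rd d → Rd d, MemLp w 2 ν →
      |∫ p, ⟪p.2 - p.1, w p.2⟫ ∂π - ∫ x, fderiv ℝ χ x (w x) ∂ν| ≤ ε * √(∫ x, ‖w x‖ ^ 2 ∂ν) := by
    intro w hw
    have h := h2 w hw
    have e := MeasurableEquiv.prodComm.measurableEmbedding.integral_map (μ := π)
      fun p : Rd d × Rd d => ⟪p.1 - p.2, w p.1⟫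
    exact e ▸ h
  refine ⟨φ, χ, 2 * (Cφ + Cχ + 1), hφ, hφc, hχ, hχc, h1, h2', fun μ' ν' hμ' hν' => ?_⟩
  have hlim : Tendsto (fun δ : ℝ => W2 μ ν ^ 2 + 2 * (∫ x, φ x ∂μ' - ∫ x, φ x ∂μ)
      + 2 * (∫ x, χ x ∂ν' - ∫ x, χ x ∂ν) + 2 * ε * (√(W2 μ μ' ^ 2 + δ) + √(W2 ν ν' ^ 2 + δ))
      + 2 * (Cφ + Cχ + 1) * ((W2 μ μ' ^ 2 + δ) + (W2 ν ν' ^ 2 + δ))) (𝓝[>] 0)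
      (𝓝 (W2 μ ν ^ 2 + 2 * (∫ x, φ x ∂μ' - ∫ x, φ x ∂μ)
      + 2 * (∫ x, χ x ∂ν' - ∫ x, χ x ∂ν) + 2 * ε * (W2 μ μ' + W2 ν ν')
      + 2 * (Cφ + Cχ + 1) * (W2 μ μ' ^ 2 + W2 ν ν' ^ 2))) := by
    refine (tendsto_const_nhds.add (((tendsto_sqrt_sq_add _ (W2_nonneg _ _)).add
      (tendsto_sqrt_sq_add _ (W2_nonneg _ _))).const_mul _)).add (Tendsto.const_mul _ ?_)
    have h : Continuous fun δ : ℝ => (W2 μ μ' ^ 2 + δ) + (W2 ν ν' ^ 2 + δ) := by fun_prop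
    have := h.tendsto 0
    rw [add_zero, add_zero] at this
    exact this.mono_left nhdsWithin_le_nhds
  refine ge_of_tendsto hlim (eventually_mem_nhdsWithin.mono fun δ (hδ : 0 < δ) => ?_)
  obtain ⟨γ, hγ, hγc⟩ := exists_isCoupling_integral_le hμ hμ' hδ
  obtain ⟨η, hη, hηc⟩ := exists_isCoupling_integral_le hν hν' hδ
  have := hγ.isProbabilityMeasure
  have := hη.isProbabilityMeasure
  have hmain := hπ.W2sq_toReal_le hμ hν hμ' hν' hγ hη
  obtain ⟨m1, n1⟩ := hγ.memLp_meanDisplacement hμ hμ'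
  obtain ⟨m2, n2⟩ := hη.memLp_meanDisplacement hν hν'
  have a1 := (abs_le.1 (h1 _ m1)).2
  have a2 := (abs_le.1 (h2' _ m2)).2
  have b1 := (abs_le.1 (hγ.abs_integral_fderiv_meanDisplacement_sub_le hμ hμ' hφ hφc hTφ)).2
  have b2 := (abs_le.1 (hη.abs_integral_fderiv_meanDisplacement_sub_le hν hν' hχ hχc hTχ)).2
  have c1 := mul_le_mul_of_nonneg_left (Real.sqrt_le_sqrt (n1.trans hγc)) hε.le
  have c2 := mul_le_mul_of_nonneg_left (Real.sqrt_le_sqrt (n2.trans hηc)) hε.le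
  have g1 := mul_le_mul_of_nonneg_left hγc hCφ
  have g2 := mul_le_mul_of_nonneg_left hηc hCχ
  have k1 : 0 ≤ Cχ * (W2 μ μ' ^ 2 + δ) := by positivity
  have k2 : 0 ≤ Cφ * (W2 ν ν' ^ 2 + δ) := by positivity
  rw [W2_sq μ' ν', W2_sq μ ν]
  linarith

lemma absolutelyContinuousOnInterval_of_dist_le {X Y : Type*} [PseudoMetricSpace X]
    [PseudoMetricSpace Y] {f : ℝ → X} {g : ℝ → Y} {a b C : ℝ}
    (hg : AbsolutelyContinuousOnInterval g a b)
    (h : ∀ s ∈ uIcc a b, ∀ t ∈ uIcc a b, dist (f s) (f t) ≤ C * dist (g s) (g t)) :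
    AbsolutelyContinuousOnInterval f a b := by
  have h0 := Tendsto.const_mul C hg
  rw [mul_zero] at h0
  refine tendsto_of_tendsto_of_tendsto_of_le_of_le' tendsto_const_nhds h0
    (Eventually.of_forall fun E => Finset.sum_nonneg fun _ _ => dist_nonneg) ?_
  filter_upwards [mem_inf_of_right (mem_principal_self _)] with E hE
  rw [Finset.mul_sum]
  exact Finset.sum_le_sum fun i hi => h _ (hE.1 i hi).1 _ (hE.1 i hi).2

lemma IsAbsCont.exists_modulus {T : ℝ} (hT : 0 < T) {ρ : ℝ → Measure (Rd d)}
    (h : IsAbsCont T ρ) :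
    ∃ G : ℝ → ℝ, AbsolutelyContinuousOnInterval G 0 T ∧
      ∀ s ∈ Icc 0 T, ∀ t ∈ Icc 0 T, W2 (ρ s) (ρ t) ≤ |G s - G t| := by
  obtain ⟨g, hg, hW⟩ := h
  have hgi : IntervalIntegrable g volume 0 T :=
    (intervalIntegrable_iff_integrableOn_Icc_of_le hT.le).2 hg
  refine ⟨fun t => ∫ τ in (0 : ℝ)..t, g τ,
    hgi.absolutelyContinuousOnInterval_intervalIntegral left_mem_uIcc, ?_⟩
  have key : ∀ s t : ℝ, 0 ≤ s → s ≤ t → t ≤ T →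
      W2 (ρ s) (ρ t) ≤ |(∫ τ in (0 : ℝ)..t, g τ) - ∫ τ in (0 : ℝ)..s, g τ| := by
    intro s t hs hst ht
    have hsub : ∀ r, 0 ≤ r → r ≤ T → IntervalIntegrable g volume 0 r := fun r h0 h1 =>
      hgi.mono_set (by rw [uIcc_of_le h0, uIcc_of_le hT.le]; exact Icc_subset_Icc_right h1)
    rw [intervalIntegral.integral_interval_sub_left (hsub t (hs.trans hst) ht)
      (hsub s hs (hst.trans ht)), intervalIntegral.integral_of_le hst]
    exact (hW s t hs hst ht).trans (le_abs_self _)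
  intro s hs t ht
  rcases le_total s t with hst | hst
  · rw [abs_sub_comm]
    exact key s t hs.1 hst ht.2
  · rw [W2_comm]
    exact key t s ht.1 hst hs.2

/-- A curve that is continuous for the Wasserstein distance is measurable. -/
lemma measurable_of_W2_le {ρ : ℝ → Measure (Rd d)} (hρ : ∀ t, IsP2 (ρ t)) {G : ℝ → ℝ}
    (hG : Continuous G) (h : ∀ s t, W2 (ρ s) (ρ t) ≤ |G s - G t|) : Measurable ρ := by
  have hp : ∀ t, IsProbabilityMeasure (ρ t) := fun t => (hρ t).1
  refine Measurable.measure_of_isPiSystem_of_isProbabilityMeasure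
    (BorelSpace.measurable_eq.trans borel_eq_generateFrom_isClosed) isPiSystem_isClosed ?_
  intro F hF
  have hδ : ∀ n : ℕ, (0 : ℝ) < 1 / ((n : ℝ) + 1) := fun n => Nat.one_div_pos_of_nat
  have hlim := fun t => tendsto_integral_thickenedIndicator_of_isClosed (ρ t) hF hδ
    tendsto_one_div_add_atTop_nhds_zero_nat
  have hc : ∀ n : ℕ, Continuous fun t => ∫ x, (thickenedIndicator (hδ n) F x : ℝ) ∂(ρ t) := by
    intro n
    obtain ⟨L, hL⟩ : ∃ L, LipschitzWith L fun x => (thickenedIndicator (hδ n) F x : ℝ) :=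
      ⟨_, lipschitzWith_thickenedIndicator (hδ n) F⟩
    have hi := fun t => integrable_thickenedIndicator (μ := ρ t) F (hδ n)
    rw [continuous_iff_continuousAt]
    intro t
    have h0 : Tendsto (fun s => L * |G t - G s|) (𝓝 t) (𝓝 0) := by
      have : Continuous fun s => L * |G t - G s| := by fun_prop
      simpa using this.tendsto t
    refine tendsto_iff_dist_tendsto_zero.2 (squeeze_zero (fun _ => dist_nonneg) (fun s => ?_) h0)
    refine (abs_integral_sub_integral_le (hρ t) (hρ s) L.2 hL.continuous
      (fun x y => ?_) (hi t) (hi s)).trans ?_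
    · rw [← Real.dist_eq, ← dist_eq_norm]
      exact hL.dist_le_mul x y
    · exact mul_le_mul_of_nonneg_left (h t s) L.2
  have hreal : Measurable fun t => (ρ t).real F :=
    measurable_of_tendsto_metrizable (fun n => (hc n).measurable) (tendsto_pi_nhds.2 hlim)
  have e : (fun t => ρ t F) = fun t => ENNReal.ofReal ((ρ t).real F) := by
    ext t
    rw [ofReal_measureReal]
  rw [e]
  exact hreal.ennreal_ofReal

lemma exists_countable_dense_range {ι X : Type*} [PseudoMetricSpace X]
    [SecondCountableTopology X] (f : ι → X) :
    ∃ S : Set ι, S.Countable ∧ ∀ i, ∀ ε > 0, ∃ j ∈ S, dist (f i) (f j) < ε := by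
  obtain ⟨D, hD, hDd⟩ := TopologicalSpace.exists_countable_dense (range f)
  choose r hr using fun x : range f => x.2
  refine ⟨r '' D, hD.image r, fun i ε hε => ?_⟩
  obtain ⟨y, hy, hyd⟩ := hDd.exists_dist_lt ⟨f i, mem_range_self i⟩ hε
  refine ⟨r y, mem_image_of_mem r hy, ?_⟩
  rw [hr]
  exact hyd

/-- Test functions contain a countable subset that is dense for the uniform distance of the
derivatives. -/
lemma exists_countable_dense_test :
    ∃ S : Set (Rd d → ℝ), S.Countable ∧
      (∀ φ ∈ S, ContDiff ℝ ((⊤ : ℕ∞) : WithTop ℕ∞) φ ∧ HasCompactSupport φ) ∧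
      ∀ φ, ContDiff ℝ ((⊤ : ℕ∞) : WithTop ℕ∞) φ → HasCompactSupport φ → ∀ ε > 0,
        ∃ χ ∈ S, ∀ x, ‖fderiv ℝ φ x - fderiv ℝ χ x‖ ≤ ε := by
  let ι (n : ℕ) : Type := {φ : Rd d → ℝ // ContDiff ℝ ((⊤ : ℕ∞) : WithTop ℕ∞) φ ∧
    tsupport φ ⊆ closedBall 0 n}
  let f (n : ℕ) (φ : ι n) : C(closedBall (0 : Rd d) n, Rd d →L[ℝ] ℝ) :=
    ⟨fun x => fderiv ℝ φ.1 x, (φ.2.1.continuous_fderiv (by simp)).comp continuous_subtype_val⟩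
  choose S hS hSd using fun n => exists_countable_dense_range (f n)
  refine ⟨⋃ n, Subtype.val '' S n, countable_iUnion fun n => (hS n).image _, ?_, ?_⟩
  · simp only [mem_iUnion]
    rintro _ ⟨n, φ, -, rfl⟩
    exact ⟨φ.2.1, HasCompactSupport.of_support_subset_isCompact (isCompact_closedBall 0 (n : ℝ))
      ((subset_tsupport _).trans φ.2.2)⟩
  · intro φ hφ hφc ε hε
    obtain ⟨R, hR⟩ := hφc.isCompact.isBounded.subset_closedBall 0
    obtain ⟨n, hn⟩ := exists_nat_ge R
    let φ' : ι n := ⟨φ, hφ, hR.trans (closedBall_subset_closedBall hn)⟩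
    obtain ⟨χ, hχ, hd⟩ := hSd n φ' ε hε
    refine ⟨χ.1, mem_iUnion.2 ⟨n, mem_image_of_mem _ hχ⟩, fun x => ?_⟩
    by_cases hx : x ∈ closedBall (0 : Rd d) n
    · rw [← dist_eq_norm]
      exact (ContinuousMap.dist_apply_le_dist (f := f n φ') (g := f n χ) ⟨x, hx⟩).trans hd.le
    · have h1 : fderiv ℝ φ x = 0 :=
        image_eq_zero_of_notMem_tsupport fun h => hx (φ'.2.2 (tsupport_fderiv_subset ℝ h))
      have h2 : fderiv ℝ χ.1 x = 0 :=
        image_eq_zero_of_notMem_tsupport fun h => hx (χ.2.2 (tsupport_fderiv_subset ℝ h))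
      rw [h1, h2, sub_zero, norm_zero]
      exact hε.le

lemma abs_sub_le_of_hasDerivAt_of_le {f g : ℝ → ℝ} {D D' t A C : ℝ} (hf : HasDerivAt f D t)
    (hg : HasDerivAt g D' t) (hfg : f t = g t)
    (h : ∀ᶠ s in 𝓝 t, f s ≤ g s + A * |s - t| + C * |s - t| ^ 2) : |D - D'| ≤ A := by
  have hk := hf.sub hg
  have hz : (f - g) t = 0 := by simp [hfg]
  rw [hasDerivAt_iff_tendsto_slope] at hk
  have hlim : Tendsto (fun s => A + C * |s - t|) (𝓝 t) (𝓝 A) := by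
    have : Continuous fun s => A + C * |s - t| := by fun_prop
    simpa using this.tendsto t
  rw [abs_le]
  constructor
  · have h1 := hk.mono_left (nhdsWithin_mono t fun s (hs : s ∈ Iio t) => ne_of_lt hs)
    have h2 := (hlim.mono_left (nhdsWithin_le_nhds (s := Iio t))).neg
    refine le_of_tendsto_of_tendsto h2 h1 ?_
    filter_upwards [nhdsWithin_le_nhds h, self_mem_nhdsWithin] with s hs (hst : s < t)
    rw [slope_def_field, hz, sub_zero, le_div_iff_of_neg (by linarith)]
    rw [abs_of_neg (by linarith)] at hs ⊢
    simp only [Pi.sub_apply]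
    linarith
  · have h1 := hk.mono_left (nhdsWithin_mono t fun s (hs : s ∈ Ioi t) => ne_of_gt hs)
    have h2 := (hlim.mono_left (nhdsWithin_le_nhds (s := Ioi t)))
    refine le_of_tendsto_of_tendsto h1 h2 ?_
    filter_upwards [nhdsWithin_le_nhds h, self_mem_nhdsWithin] with s hs (hst : t < s)
    rw [slope_def_field, hz, sub_zero, div_le_iff₀ (by linarith)]
    rw [abs_of_pos (by linarith)] at hs ⊢
    simp only [Pi.sub_apply]
    linarith

lemma exists_fderiv_bound {φ : Rd d → ℝ} (hφ : ContDiff ℝ ((⊤ : ℕ∞) : WithTop ℕ∞) φ)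
    (hφc : HasCompactSupport φ) : ∃ B : ℝ≥0, ∀ x, ‖fderiv ℝ φ x‖ ≤ B := by
  obtain ⟨B, hB⟩ := (hφc.fderiv ℝ).exists_bound_of_continuous (hφ.continuous_fderiv (by simp))
  exact ⟨B.toNNReal, fun x => (hB x).trans (Real.le_coe_toNNReal B)⟩

lemma abs_integral_sub_integral_le_of_fderiv_le {μ μ' : Measure (Rd d)} (hμ : IsP2 μ)
    (hμ' : IsP2 μ') {φ : Rd d → ℝ} (hφ : ContDiff ℝ ((⊤ : ℕ∞) : WithTop ℕ∞) φ)
    (hφc : HasCompactSupport φ) {B : ℝ} (hB : ∀ x, ‖fderiv ℝ φ x‖ ≤ B) :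
    |∫ x, φ x ∂μ' - ∫ x, φ x ∂μ| ≤ B * W2 μ μ' := by
  refine abs_integral_sub_integral_le hμ hμ' ((norm_nonneg _).trans (hB 0)) hφ.continuous
    (fun x y => ?_) (hμ.integrable_of_hasCompactSupport hφ.continuous hφc)
    (hμ'.integrable_of_hasCompactSupport hφ.continuous hφc)
  exact convex_univ.norm_image_sub_le_of_norm_fderiv_le (𝕜 := ℝ)
    (fun z _ => hφ.differentiable (by simp) z) (fun z _ => hB z) (mem_univ y) (mem_univ x)

lemma integrable_fderiv_apply {μ : Measure (Rd d)} [IsFiniteMeasure μ] {φ : Rd d → ℝ}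
    (hφ : ContDiff ℝ ((⊤ : ℕ∞) : WithTop ℕ∞) φ) (hφc : HasCompactSupport φ) {w : Rd d → Rd d}
    (hw : MemLp w 2 μ) : Integrable (fun x => fderiv ℝ φ x (w x)) μ := by
  simpa only [inner_gradient] using integrable_inner_of_memLp (memLp_gradient hφ hφc) hw

/-- A curve in the Wasserstein space, extended by constants outside of a time interval. -/
lemma exists_kernel_eq {T : ℝ} (hT : 0 < T) {ρ : ℝ → Measure (Rd d)}
    (hρ : ∀ t ∈ Icc 0 T, IsP2 (ρ t)) {G : ℝ → ℝ} (hG : AbsolutelyContinuousOnInterval G 0 T)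
    (h : ∀ s ∈ Icc 0 T, ∀ t ∈ Icc 0 T, W2 (ρ s) (ρ t) ≤ |G s - G t|) :
    ∃ κ : ProbabilityTheory.Kernel ℝ (Rd d), ProbabilityTheory.IsMarkovKernel κ ∧
      ∀ t ∈ Icc 0 T, κ t = ρ t := by
  let p : ℝ → ℝ := fun t => projIcc 0 T hT.le t
  have hp : ∀ t, p t ∈ Icc 0 T := fun t => (projIcc 0 T hT.le t).2
  have hpc : Continuous p := continuous_subtype_val.comp continuous_projIcc
  have hGc : Continuous fun t => G (p t) := by
    have := hG.continuousOn
    rw [uIcc_of_le hT.le] at this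
    exact this.comp_continuous hpc hp
  refine ⟨⟨fun t => ρ (p t), measurable_of_W2_le (fun t => hρ _ (hp t)) hGc
    fun s t => h _ (hp s) _ (hp t)⟩, ⟨fun t => (hρ _ (hp t)).1⟩, fun t ht => ?_⟩
  change ρ (projIcc 0 T hT.le t) = ρ t
  rw [projIcc_of_mem hT.le ht]

lemma ae_memLp_velocity {T : ℝ} (hT : 0 < T) {ρ : ℝ → Measure (Rd d)}
    {u : ℝ → Rd d → Rd d} (hρ : ∀ t ∈ Icc 0 T, IsP2 (ρ t)) {G : ℝ → ℝ}
    (hG : AbsolutelyContinuousOnInterval G 0 T)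
    (hW : ∀ s ∈ Icc 0 T, ∀ t ∈ Icc 0 T, W2 (ρ s) (ρ t) ≤ |G s - G t|)
    (hum : Measurable fun p : ℝ × Rd d => u p.1 p.2)
    (huL2 : ∫⁻ t in Icc (0:ℝ) T, ∫⁻ x, (‖u t x‖₊ : ℝ≥0∞) ^ 2 ∂(ρ t) < ⊤) :
    ∀ᵐ t ∂(volume.restrict (Icc 0 T)), MemLp (u t) 2 (ρ t) := by
  obtain ⟨κ, hκ, hκρ⟩ := exists_kernel_eq hT hρ hG hW
  have hE : Measurable fun t => ∫⁻ x, (‖u t x‖₊ : ℝ≥0∞) ^ 2 ∂(κ t) :=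
    Measurable.lintegral_kernel_prod_right (f := fun t x => (‖u t x‖₊ : ℝ≥0∞) ^ 2)
      (by simp only [Function.uncurry_def]; fun_prop)
  have hfin : ∫⁻ t in Icc (0:ℝ) T, ∫⁻ x, (‖u t x‖₊ : ℝ≥0∞) ^ 2 ∂(κ t) ≠ ⊤ := by
    rw [setLIntegral_congr_fun measurableSet_Icc fun t ht => by rw [hκρ t ht]]
    exact huL2.ne
  filter_upwards [ae_lt_top hE hfin, ae_restrict_mem measurableSet_Icc] with t ht htI
  rw [hκρ t htI] at ht
  have hut : Measurable (u t) := hum.comp measurable_prodMk_left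
  exact (memLp_two_iff_lintegral_nnnorm_sq_lt_top hut.aestronglyMeasurable).2 ht

lemma integrableOn_integral_fderiv {T : ℝ} (hT : 0 < T) {ρ : ℝ → Measure (Rd d)}
    {u : ℝ → Rd d → Rd d} (hρ : ∀ t ∈ Icc 0 T, IsP2 (ρ t)) {G : ℝ → ℝ}
    (hG : AbsolutelyContinuousOnInterval G 0 T)
    (hW : ∀ s ∈ Icc 0 T, ∀ t ∈ Icc 0 T, W2 (ρ s) (ρ t) ≤ |G s - G t|)
    (hum : Measurable fun p : ℝ × Rd d => u p.1 p.2)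
    (huL2 : ∫⁻ t in Icc (0:ℝ) T, ∫⁻ x, (‖u t x‖₊ : ℝ≥0∞) ^ 2 ∂(ρ t) < ⊤)
    {φ : Rd d → ℝ} (hφ : ContDiff ℝ ((⊤ : ℕ∞) : WithTop ℕ∞) φ) (hφc : HasCompactSupport φ) :
    IntegrableOn (fun t => ∫ x, fderiv ℝ φ x (u t x) ∂(ρ t)) (Icc 0 T) := by
  obtain ⟨κ, hκ, hκρ⟩ := exists_kernel_eq hT hρ hG hW
  obtain ⟨B, hB⟩ := exists_fderiv_bound hφ hφc
  have hfc : Continuous (fderiv ℝ φ) := hφ.continuous_fderiv (by simp)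
  have hm : Measurable fun p : ℝ × Rd d => fderiv ℝ φ p.2 (u p.1 p.2) :=
    (isBoundedBilinearMap_apply (𝕜 := ℝ) (E := Rd d) (F := ℝ)).continuous.measurable.comp
      ((hfc.measurable.comp measurable_snd).prodMk hum)
  have hI : StronglyMeasurable fun t => ∫ x, fderiv ℝ φ x (u t x) ∂(κ t) :=
    StronglyMeasurable.integral_kernel_prod_right' (κ := κ) hm.stronglyMeasurable
  refine ⟨hI.aestronglyMeasurable.congr ?_, ?_⟩
  · filter_upwards [ae_restrict_mem measurableSet_Icc] with t ht
    rw [hκρ t ht]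
  · have hbound : ∀ t ∈ Icc 0 T, ‖∫ x, fderiv ℝ φ x (u t x) ∂(ρ t)‖ₑ
        ≤ B * (1 + ∫⁻ x, (‖u t x‖₊ : ℝ≥0∞) ^ 2 ∂(ρ t)) := by
      intro t ht
      have := (hρ t ht).1
      have hpt : ∀ x, ‖fderiv ℝ φ x (u t x)‖ₑ ≤ B * (1 + (‖u t x‖₊ : ℝ≥0∞) ^ 2) := by
        intro x
        have h1 : ‖fderiv ℝ φ x (u t x)‖₊ ≤ B * (1 + ‖u t x‖₊ ^ 2) := by
          refine NNReal.coe_le_coe.1 ?_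
          push_cast
          refine ((fderiv ℝ φ x).le_of_opNorm_le (hB x) _).trans ?_
          gcongr
          nlinarith [sq_nonneg (‖u t x‖ - 1)]
        rw [enorm_eq_nnnorm]
        exact_mod_cast h1
      refine (enorm_integral_le_lintegral_enorm _).trans ((lintegral_mono hpt).trans ?_)
      rw [lintegral_const_mul' _ _ ENNReal.coe_ne_top, lintegral_add_left measurable_const]
      simp
    refine lt_of_le_of_lt (setLIntegral_mono' measurableSet_Icc hbound) ?_
    rw [lintegral_const_mul' _ _ ENNReal.coe_ne_top, lintegral_add_left measurable_const]
    refine ENNReal.mul_lt_top ENNReal.coe_lt_top (ENNReal.add_lt_top.2 ⟨?_, huL2⟩)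
    simp

lemma IsContEqSol.integral_mul_eq_zero {T : ℝ} {ρ : ℝ → Measure (Rd d)} {u : ℝ → Rd d → Rd d}
    (hρ : ∀ t ∈ Icc 0 T, IsP2 (ρ t)) (hu : IsContEqSol T ρ u)
    (huL2 : ∀ᵐ t ∂(volume.restrict (Icc 0 T)), MemLp (u t) 2 (ρ t))
    {φ : Rd d → ℝ} (hφ : ContDiff ℝ ((⊤ : ℕ∞) : WithTop ℕ∞) φ) (hφc : HasCompactSupport φ)
    {η : ℝ → ℝ} (hη : ContDiff ℝ ((⊤ : ℕ∞) : WithTop ℕ∞) η) (hηc : HasCompactSupport η)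
    (hηT : tsupport η ⊆ Ioo 0 T) :
    ∫ t in Ioo (0:ℝ) T, (deriv η t * (∫ x, φ x ∂(ρ t)) +
      η t * (∫ x, fderiv ℝ φ x (u t x) ∂(ρ t))) = 0 := by
  have hsupp : (Function.support fun p : ℝ × Rd d => η p.1 * φ p.2) ⊆ tsupport η ×ˢ tsupport φ := by
    intro p hp
    have hp' : η p.1 * φ p.2 ≠ 0 := hp
    exact ⟨subset_tsupport _ (left_ne_zero_of_mul hp'),
      subset_tsupport _ (right_ne_zero_of_mul hp')⟩
  have htsupp : (tsupport fun p : ℝ × Rd d => η p.1 * φ p.2) ⊆ tsupport η ×ˢ tsupport φ :=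
    closure_minimal hsupp ((isClosed_tsupport η).prod (isClosed_tsupport φ))
  have key := hu (fun t x => η t * φ x)
    (ContDiff.mul (hη.comp contDiff_fst) (hφ.comp contDiff_snd))
    (HasCompactSupport.of_support_subset_isCompact (hηc.isCompact.prod hφc.isCompact) hsupp)
    (htsupp.trans (prod_mono hηT (subset_univ _)))
  refine (integral_congr_ae ?_).trans key
  have h1 : ∀ᵐ t ∂(volume.restrict (Ioo 0 T)), MemLp (u t) 2 (ρ t) :=
    ae_mono (Measure.restrict_mono Ioo_subset_Icc_self le_rfl) huL2
  filter_upwards [h1, ae_restrict_mem measurableSet_Ioo] with t htu ht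
  have hP := hρ t (Ioo_subset_Icc_self ht)
  have := hP.1
  have hd : ∀ x, deriv (fun s => η s * φ x) t = deriv η t * φ x := fun x =>
    deriv_mul_const (hη.differentiable (by simp) t) (φ x)
  have hg : ∀ x, ⟪u t x, gradient (fun y => η t * φ y) x⟫ = η t * fderiv ℝ φ x (u t x) := by
    intro x
    rw [gradient_const_mul_of_contDiff _ hφ, Pi.smul_apply, real_inner_smul_right,
      real_inner_comm, inner_gradient]
  simp only [hd, hg]
  rw [integral_add ((hP.integrable_of_hasCompactSupport hφ.continuous hφc).const_mul _)
    ((integrable_fderiv_apply hφ hφc htu).const_mul _), integral_const_mul, integral_const_mul]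

lemma absolutelyContinuousOnInterval_integral {T : ℝ} (hT : 0 < T) {ρ : ℝ → Measure (Rd d)}
    (hρ : ∀ t ∈ Icc 0 T, IsP2 (ρ t)) {G : ℝ → ℝ} (hG : AbsolutelyContinuousOnInterval G 0 T)
    (hW : ∀ s ∈ Icc 0 T, ∀ t ∈ Icc 0 T, W2 (ρ s) (ρ t) ≤ |G s - G t|)
    {φ : Rd d → ℝ} (hφ : ContDiff ℝ ((⊤ : ℕ∞) : WithTop ℕ∞) φ) (hφc : HasCompactSupport φ) :
    AbsolutelyContinuousOnInterval (fun t => ∫ x, φ x ∂(ρ t)) 0 T := by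
  obtain ⟨B, hB⟩ := exists_fderiv_bound hφ hφc
  refine absolutelyContinuousOnInterval_of_dist_le (C := B) hG ?_
  rw [uIcc_of_le hT.le]
  intro s hs t ht
  rw [Real.dist_eq, Real.dist_eq]
  refine (abs_integral_sub_integral_le_of_fderiv_le (hρ t ht) (hρ s hs) hφ hφc hB).trans ?_
  rw [W2_comm]
  exact mul_le_mul_of_nonneg_left (hW s hs t ht) B.2

/-- Weak solutions of the continuity equation test pointwise almost everywhere in time. -/
lemma IsContEqSol.ae_hasDerivAt_integral {T : ℝ} (hT : 0 < T) {ρ : ℝ → Measure (Rd d)}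
    {u : ℝ → Rd d → Rd d} (hρ : ∀ t ∈ Icc 0 T, IsP2 (ρ t)) {G : ℝ → ℝ}
    (hG : AbsolutelyContinuousOnInterval G 0 T)
    (hW : ∀ s ∈ Icc 0 T, ∀ t ∈ Icc 0 T, W2 (ρ s) (ρ t) ≤ |G s - G t|)
    (hum : Measurable fun p : ℝ × Rd d => u p.1 p.2) (hu : IsContEqSol T ρ u)
    (huL2 : ∫⁻ t in Icc (0:ℝ) T, ∫⁻ x, (‖u t x‖₊ : ℝ≥0∞) ^ 2 ∂(ρ t) < ⊤)
    {φ : Rd d → ℝ} (hφ : ContDiff ℝ ((⊤ : ℕ∞) : WithTop ℕ∞) φ) (hφc : HasCompactSupport φ) :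
    ∀ᵐ t, t ∈ Ioo 0 T → HasDerivAt (fun s => ∫ x, φ x ∂(ρ s))
      (∫ x, fderiv ℝ φ x (u t x) ∂(ρ t)) t := by
  set m : ℝ → ℝ := fun s => ∫ x, φ x ∂(ρ s) with hm_def
  set I : ℝ → ℝ := fun t => ∫ x, fderiv ℝ φ x (u t x) ∂(ρ t) with hI_def
  have hm : AbsolutelyContinuousOnInterval m 0 T :=
    absolutelyContinuousOnInterval_integral hT hρ hG hW hφ hφc
  have hmem := ae_memLp_velocity hT hρ hG hW hum huL2
  have hI : IntegrableOn I (Icc 0 T) := integrableOn_integral_fderiv hT hρ hG hW hum huL2 hφ hφc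
  have hI' : IntegrableOn I (Ioo 0 T) := hI.mono_set Ioo_subset_Icc_self
  have hdm : IntegrableOn (deriv m) (Icc 0 T) :=
    (intervalIntegrable_iff_integrableOn_Icc_of_le hT.le).1 hm.intervalIntegrable_deriv
  have hdm' : IntegrableOn (deriv m) (Ioo 0 T) := hdm.mono_set Ioo_subset_Icc_self
  have hzero : ∀ᵐ t, t ∈ Ioo 0 T → deriv m t - I t = 0 := by
    refine IsOpen.ae_eq_zero_of_integral_contDiff_smul_eq_zero isOpen_Ioo
      (hdm'.sub hI').locallyIntegrableOn fun η hη hηc hηT => ?_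
    have hη' : AbsolutelyContinuousOnInterval η 0 T :=
      (hη.of_le (by simp)).contDiffOn.absolutelyContinuousOnInterval
    have hz : ∀ t ∉ Ioo 0 T, η t = 0 := fun t ht => image_eq_zero_of_notMem_tsupport
      fun h => ht (hηT h)
    have hparts := hη'.integral_mul_deriv_eq_deriv_mul hm
    rw [hz 0 (by simp), hz T (by simp), zero_mul, zero_mul, sub_zero, zero_sub,
      intervalIntegral.integral_of_le hT.le, intervalIntegral.integral_of_le hT.le,
      integral_Ioc_eq_integral_Ioo, integral_Ioc_eq_integral_Ioo] at hparts
    have htest := hu.integral_mul_eq_zero hρ hmem hφ hφc hη hηc hηT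
    have hηcont : Continuous η := hη.continuous
    have hmul : ∀ f : ℝ → ℝ, IntegrableOn f (Icc 0 T) →
        IntegrableOn (fun t => η t * f t) (Ioo 0 T) := fun f hf =>
      (hf.continuousOn_mul hηcont.continuousOn isCompact_Icc).mono_set Ioo_subset_Icc_self
    have hmc : ContinuousOn m (Icc 0 T) := by
      have := hm.continuousOn
      rwa [uIcc_of_le hT.le] at this
    have hdη : IntegrableOn (fun t => deriv η t * m t) (Ioo 0 T) :=
      (((hη.continuous_deriv (by simp)).continuousOn.mul hmc).integrableOn_compact
        isCompact_Icc).mono_set Ioo_subset_Icc_self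
    rw [integral_add hdη (hmul I hI)] at htest
    have hset : ∫ t, η t • (deriv m t - I t) = ∫ t in Ioo 0 T, (η t * deriv m t - η t * I t) := by
      rw [← setIntegral_eq_integral_of_forall_compl_eq_zero (s := Ioo 0 T)
        fun t ht => by rw [hz t ht, zero_smul]]
      exact integral_congr_ae (.of_forall fun t => by simp [mul_sub])
    rw [hset, integral_sub (hmul _ hdm) (hmul _ hI), hparts]
    linarith
  filter_upwards [hzero, hm.ae_differentiableAt] with t h0 hd ht
  have := (hd (by rw [uIcc_of_le hT.le]; exact Ioo_subset_Icc_self ht)).hasDerivAt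
  rwa [sub_eq_zero.1 (h0 ht)] at this

lemma hasDerivAt_integral_of_dense {ρ : ℝ → Measure (Rd d)} {t K : ℝ} {w : Rd d → Rd d}
    (hρ : ∀ᶠ s in 𝓝 t, IsP2 (ρ s)) (hw : MemLp w 2 (ρ t)) (hK : 0 ≤ K)
    (hKt : ∀ᶠ s in 𝓝 t, W2 (ρ t) (ρ s) ≤ K * |s - t|) {φ : Rd d → ℝ}
    (hφ : ContDiff ℝ ((⊤ : ℕ∞) : WithTop ℕ∞) φ) (hφc : HasCompactSupport φ)
    (h : ∀ ε > 0, ∃ χ : Rd d → ℝ, ContDiff ℝ ((⊤ : ℕ∞) : WithTop ℕ∞) χ ∧ HasCompactSupport χ ∧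
      (∀ x, ‖fderiv ℝ φ x - fderiv ℝ χ x‖ ≤ ε) ∧
      HasDerivAt (fun s => ∫ x, χ x ∂(ρ s)) (∫ x, fderiv ℝ χ x (w x) ∂(ρ t)) t) :
    HasDerivAt (fun s => ∫ x, φ x ∂(ρ s)) (∫ x, fderiv ℝ φ x (w x) ∂(ρ t)) t := by
  have hP := hρ.self_of_nhds
  have := hP.1
  have hwi : Integrable (fun x => ‖w x‖) (ρ t) := (hw.integrable (by norm_num)).norm
  set M := ∫ x, ‖w x‖ ∂(ρ t) with hM_def
  have hM : 0 ≤ M := integral_nonneg fun x => norm_nonneg _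
  refine hasDerivAt_iff_isLittleO.2 (Asymptotics.isLittleO_iff.2 fun c hc => ?_)
  set ε := c / (K + M + 1) with hε_def
  have hpos : 0 < K + M + 1 := by positivity
  have hε : 0 < ε := by positivity
  have hεc : ε * (K + M + 1) = c := div_mul_cancel₀ _ hpos.ne'
  obtain ⟨χ, hχ, hχc, hφχ, hd⟩ := h ε hε
  have hI : |∫ x, fderiv ℝ φ x (w x) ∂(ρ t) - ∫ x, fderiv ℝ χ x (w x) ∂(ρ t)| ≤ ε * M := by
    rw [← integral_sub (integrable_fderiv_apply hφ hφc hw) (integrable_fderiv_apply hχ hχc hw),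
      ← integral_const_mul]
    refine (Real.norm_eq_abs _).symm.trans_le <|
      norm_integral_le_of_norm_le (hwi.const_mul ε) (.of_forall fun x => ?_)
    exact (fderiv ℝ φ x - fderiv ℝ χ x).le_of_opNorm_le (hφχ x) (w x)
  rw [hasDerivAt_iff_isLittleO, Asymptotics.isLittleO_iff] at hd
  filter_upwards [hd hε, hρ, hKt] with s hs hsP hsK
  have hinc := abs_integral_sub_integral_le_of_fderiv_le hP hsP (hφ.sub hχ)
    (hφc.sub hχc) (B := ε) fun x => by
      rw [fderiv_fun_sub (hφ.differentiable (by simp) x) (hχ.differentiable (by simp) x)]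
      exact hφχ x
  have hint : ∀ μ : Measure (Rd d), IsP2 μ →
      ∫ x, (φ x - χ x) ∂μ = ∫ x, φ x ∂μ - ∫ x, χ x ∂μ := fun μ hμ =>
    integral_sub (hμ.integrable_of_hasCompactSupport hφ.continuous hφc)
      (hμ.integrable_of_hasCompactSupport hχ.continuous hχc)
  rw [hint _ hP, hint _ hsP] at hinc
  have hinc' := hinc.trans (mul_le_mul_of_nonneg_left hsK hε.le)
  rw [Real.norm_eq_abs, Real.norm_eq_abs, smul_eq_mul] at hs ⊢
  have hprod := mul_le_mul_of_nonneg_left hI (abs_nonneg (s - t))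
  rw [← abs_mul] at hprod
  rw [← hεc]
  rw [abs_le] at *
  constructor <;> nlinarith

lemma eventually_le_mul_abs_sub {T t : ℝ} {f : ℝ → ℝ} {G : ℝ → ℝ} (ht : t ∈ Ioo 0 T)
    (hG : DifferentiableAt ℝ G t) (h : ∀ s ∈ Icc 0 T, f s ≤ |G t - G s|) :
    ∃ K ≥ 0, ∀ᶠ s in 𝓝 t, f s ≤ K * |s - t| := by
  obtain ⟨K, hK, hKt⟩ := hG.isBigO_sub.exists_nonneg
  refine ⟨K, hK, ?_⟩
  filter_upwards [hKt.bound, Icc_mem_nhds ht.1 ht.2] with s hs hsT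
  rw [Real.norm_eq_abs, Real.norm_eq_abs, abs_sub_comm] at hs
  exact (h s hsT).trans hs

/-- At almost every time, the velocity is square integrable, the curve is Lipschitz, and the
continuity equation holds pointwise against every test function. -/
lemma IsContEqSol.ae_forall_hasDerivAt_integral {T : ℝ} (hT : 0 < T) {ρ : ℝ → Measure (Rd d)}
    {u : ℝ → Rd d → Rd d} (hρ : ∀ t ∈ Icc 0 T, IsP2 (ρ t)) {G : ℝ → ℝ}
    (hG : AbsolutelyContinuousOnInterval G 0 T)
    (hW : ∀ s ∈ Icc 0 T, ∀ t ∈ Icc 0 T, W2 (ρ s) (ρ t) ≤ |G s - G t|)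
    (hum : Measurable fun p : ℝ × Rd d => u p.1 p.2) (hu : IsContEqSol T ρ u)
    (huL2 : ∫⁻ t in Icc (0:ℝ) T, ∫⁻ x, (‖u t x‖₊ : ℝ≥0∞) ^ 2 ∂(ρ t) < ⊤) :
    ∀ᵐ t ∂(volume.restrict (Icc 0 T)), t ∈ Ioo 0 T ∧ MemLp (u t) 2 (ρ t) ∧
      (∃ K ≥ 0, ∀ᶠ s in 𝓝 t, W2 (ρ t) (ρ s) ≤ K * |s - t|) ∧
      ∀ φ : Rd d → ℝ, ContDiff ℝ ((⊤ : ℕ∞) : WithTop ℕ∞) φ → HasCompactSupport φ →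
        HasDerivAt (fun s => ∫ x, φ x ∂(ρ s)) (∫ x, fderiv ℝ φ x (u t x) ∂(ρ t)) t := by
  obtain ⟨S, hSc, hS, hdense⟩ := exists_countable_dense_test (d := d)
  have hmem := ae_memLp_velocity hT hρ hG hW hum huL2
  have hderiv : ∀ᵐ t ∂(volume.restrict (Ioo 0 T)), ∀ χ ∈ S, HasDerivAt (fun s => ∫ x, χ x ∂(ρ s))
      (∫ x, fderiv ℝ χ x (u t x) ∂(ρ t)) t := by
    refine (ae_ball_iff hSc).2 fun χ hχ => ?_
    exact (ae_restrict_iff' measurableSet_Ioo).2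
      (hu.ae_hasDerivAt_integral hT hρ hG hW hum huL2 (hS χ hχ).1 (hS χ hχ).2)
  rw [restrict_Ioo_eq_restrict_Icc] at hderiv
  have hIoo : ∀ᵐ t ∂(volume.restrict (Icc 0 T)), t ∈ Ioo 0 T := by
    rw [← restrict_Ioo_eq_restrict_Icc]
    exact ae_restrict_mem measurableSet_Ioo
  filter_upwards [hmem, hderiv, hIoo, ae_restrict_of_ae hG.ae_differentiableAt]
    with t htm htd ht htG
  have htI := Ioo_subset_Icc_self ht
  obtain ⟨K, hK, hKt⟩ := eventually_le_mul_abs_sub (f := fun s => W2 (ρ t) (ρ s)) ht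
    (htG (by rwa [uIcc_of_le hT.le])) fun s hs => hW t htI s hs
  refine ⟨ht, htm, ⟨K, hK, hKt⟩, fun φ hφ hφc => ?_⟩
  refine hasDerivAt_integral_of_dense ?_ htm hK hKt hφ hφc fun ε hε => ?_
  · filter_upwards [Icc_mem_nhds ht.1 ht.2] with s hs using hρ s hs
  · obtain ⟨χ, hχS, hχ⟩ := hdense φ hφ hφc ε hε
    exact ⟨χ, (hS χ hχS).1, (hS χ hχS).2, hχ, htd χ hχS⟩

lemma absolutelyContinuousOnInterval_of_dist_le_add {X Y Z : Type*} [PseudoMetricSpace X]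
    [PseudoMetricSpace Y] [PseudoMetricSpace Z] {f : ℝ → X} {g : ℝ → Y} {h : ℝ → Z} {a b : ℝ}
    (hg : AbsolutelyContinuousOnInterval g a b) (hh : AbsolutelyContinuousOnInterval h a b)
    (hf : ∀ s ∈ uIcc a b, ∀ t ∈ uIcc a b,
      dist (f s) (f t) ≤ dist (g s) (g t) + dist (h s) (h t)) :
    AbsolutelyContinuousOnInterval f a b := by
  have h0 := Tendsto.add hg hh
  rw [add_zero] at h0
  refine tendsto_of_tendsto_of_tendsto_of_le_of_le' tendsto_const_nhds h0
    (Eventually.of_forall fun E => Finset.sum_nonneg fun _ _ => dist_nonneg) ?_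
  filter_upwards [mem_inf_of_right (mem_principal_self _)] with E hE
  rw [← Finset.sum_add_distrib]
  exact Finset.sum_le_sum fun i hi => hf _ (hE.1 i hi).1 _ (hE.1 i hi).2

lemma IsOptimalPlan.integral_inner_sub {μ ν : Measure (Rd d)} {π : Measure (Rd d × Rd d)}
    (hπ : IsOptimalPlan π μ ν) (hμ : IsP2 μ) (hν : IsP2 ν) {u v : Rd d → Rd d}
    (hu : MemLp u 2 μ) (hv : MemLp v 2 ν) :
    ∫ p : Rd d × Rd d, ⟪u p.1 - v p.2, p.1 - p.2⟫ ∂π =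
      ∫ p : Rd d × Rd d, ⟪p.1 - p.2, u p.1⟫ ∂π + ∫ p : Rd d × Rd d, ⟪p.2 - p.1, v p.2⟫ ∂π := by
  have hu' : MemLp (fun p : Rd d × Rd d => u p.1) 2 π :=
    hu.comp_measurePreserving hπ.1.measurePreserving_fst
  have hv' : MemLp (fun p : Rd d × Rd d => v p.2) 2 π :=
    hv.comp_measurePreserving hπ.1.measurePreserving_snd
  rw [← integral_add (integrable_inner_of_memLp (hπ.1.memLp_sub hμ hν) hu')
    (integrable_inner_of_memLp (hπ.1.memLp_sub' hμ hν) hv')]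
  refine integral_congr_ae (.of_forall fun p => ?_)
  simp only [inner_sub_left, inner_sub_right, real_inner_comm]
  ring

/-- If the squared Wasserstein distance along two curves is differentiable at a time at which
both curves are Lipschitz and satisfy the continuity equation, then its derivative is given by
the first variation along any optimal plan. -/
lemma IsOptimalPlan.eq_of_hasDerivAt_W2_sq {μ ν : ℝ → Measure (Rd d)} {t D K L : ℝ}
    {u v : Rd d → Rd d} {π : Measure (Rd d × Rd d)} (hπ : IsOptimalPlan π (μ t) (ν t))
    (hD : HasDerivAt (fun s => W2 (μ s) (ν s) ^ 2) D t)
    (hμ : ∀ᶠ s in 𝓝 t, IsP2 (μ s)) (hν : ∀ᶠ s in 𝓝 t, IsP2 (ν s))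
    (hu : MemLp u 2 (μ t)) (hv : MemLp v 2 (ν t)) (hK : 0 ≤ K) (hL : 0 ≤ L)
    (hKt : ∀ᶠ s in 𝓝 t, W2 (μ t) (μ s) ≤ K * |s - t|)
    (hLt : ∀ᶠ s in 𝓝 t, W2 (ν t) (ν s) ≤ L * |s - t|)
    (hμu : ∀ φ : Rd d → ℝ, ContDiff ℝ ((⊤ : ℕ∞) : WithTop ℕ∞) φ → HasCompactSupport φ →
        HasDerivAt (fun s => ∫ x, φ x ∂(μ s)) (∫ x, fderiv ℝ φ x (u x) ∂(μ t)) t)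
    (hνv : ∀ φ : Rd d → ℝ, ContDiff ℝ ((⊤ : ℕ∞) : WithTop ℕ∞) φ → HasCompactSupport φ →
        HasDerivAt (fun s => ∫ x, φ x ∂(ν s)) (∫ x, fderiv ℝ φ x (v x) ∂(ν t)) t) :
    D = 2 * ∫ p : Rd d × Rd d, ⟪u p.1 - v p.2, p.1 - p.2⟫ ∂π := by
  have hμt := hμ.self_of_nhds
  have hνt := hν.self_of_nhds
  rw [hπ.integral_inner_sub hμt hνt hu hv]
  set P := ∫ p : Rd d × Rd d, ⟪p.1 - p.2, u p.1⟫ ∂π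
  set Q := ∫ p : Rd d × Rd d, ⟪p.2 - p.1, v p.2⟫ ∂π
  set a := √(∫ x, ‖u x‖ ^ 2 ∂(μ t))
  set b := √(∫ x, ‖v x‖ ^ 2 ∂(ν t))
  have ha : 0 ≤ a := Real.sqrt_nonneg _
  have hb : 0 ≤ b := Real.sqrt_nonneg _
  have key : ∀ ε > 0, |D - 2 * (P + Q)| ≤ ε * (2 * (K + L + a + b)) := by
    intro ε hε
    obtain ⟨φ, χ, C, hφ, hφc, hχ, hχc, hφu, hχv, hle⟩ := hπ.exists_W2_sq_le hμt hνt hε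
    have hg := (((hμu φ hφ hφc).sub_const (∫ x, φ x ∂(μ t))).const_mul 2).const_add
      (W2 (μ t) (ν t) ^ 2) |>.add
        (((hνv χ hχ hχc).sub_const (∫ x, χ x ∂(ν t))).const_mul 2)
    have hbound := abs_sub_le_of_hasDerivAt_of_le (A := 2 * ε * (K + L))
      (C := |C| * (K ^ 2 + L ^ 2)) hD hg (by simp) (by
        filter_upwards [hμ, hν, hKt, hLt] with s hμs hνs hKs hLs
        have h1 := hle (μ s) (ν s) hμs hνs
        have h2 : W2 (μ t) (μ s) + W2 (ν t) (ν s) ≤ (K + L) * |s - t| := by linarith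
        have h3 : W2 (μ t) (μ s) ^ 2 + W2 (ν t) (ν s) ^ 2 ≤ (K ^ 2 + L ^ 2) * |s - t| ^ 2 := by
          have h4 := pow_le_pow_left₀ (W2_nonneg _ _) hKs 2
          have h5 := pow_le_pow_left₀ (W2_nonneg _ _) hLs 2
          rw [mul_pow] at h4 h5
          linarith
        have h6 : C * (W2 (μ t) (μ s) ^ 2 + W2 (ν t) (ν s) ^ 2)
            ≤ |C| * ((K ^ 2 + L ^ 2) * |s - t| ^ 2) :=
          (mul_le_mul_of_nonneg_right (le_abs_self C) (by positivity)).trans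
            (mul_le_mul_of_nonneg_left h3 (abs_nonneg C))
        have h7 := mul_le_mul_of_nonneg_left h2 (by positivity : 0 ≤ 2 * ε)
        simp only [Pi.add_apply]
        linarith)
    have h1 := hφu u hu
    have h2 := hχv v hv
    rw [abs_le] at *
    constructor <;> linarith
  have hM : 0 ≤ 2 * (K + L + a + b) := by positivity
  have h0 : |D - 2 * (P + Q)| ≤ 0 := by
    refine le_of_forall_pos_le_add fun δ hδ => ?_
    refine (key (δ / (2 * (K + L + a + b) + 1)) (by positivity)).trans ?_
    rw [zero_add, div_mul_eq_mul_div, div_le_iff₀ (by positivity)]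
    nlinarith
  exact sub_eq_zero.1 (abs_nonpos_iff.1 h0)

end MSP

/-- Lemma (derivative of the squared Wasserstein distance along two absolutely
continuous curves). -/
theorem stmt14 {d : ℕ} (T : ℝ) (hT : 0 < T)
    (μ ν : ℝ → Measure (Rd d)) (u v : ℝ → Rd d → Rd d)
    (hμ2 : ∀ t ∈ Icc (0:ℝ) T, IsP2 (μ t)) (hν2 : ∀ t ∈ Icc (0:ℝ) T, IsP2 (ν t))
    (hμac : IsAbsCont T μ) (hνac : IsAbsCont T ν)
    (hum : Measurable (fun p : ℝ × Rd d => u p.1 p.2))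
    (hvm : Measurable (fun p : ℝ × Rd d => v p.1 p.2))
    (hue : IsContEqSol T μ u) (hve : IsContEqSol T ν v)
    (huL2 : ∫⁻ t in Icc (0:ℝ) T, ∫⁻ x, (‖u t x‖₊ : ℝ≥0∞) ^ 2 ∂(μ t) < ⊤)
    (hvL2 : ∫⁻ t in Icc (0:ℝ) T, ∫⁻ x, (‖v t x‖₊ : ℝ≥0∞) ^ 2 ∂(ν t) < ⊤) :
    ∀ᵐ t ∂(volume.restrict (Icc (0:ℝ) T)),
      ∀ π : Measure (Rd d × Rd d), IsOptimalPlan π (μ t) (ν t) →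
        HasDerivAt (fun s => W2 (μ s) (ν s) ^ 2)
          (2 * ∫ p : Rd d × Rd d, ⟪u t p.1 - v t p.2, p.1 - p.2⟫ ∂π) t := by
  obtain ⟨G, hG, hGW⟩ := hμac.exists_modulus hT
  obtain ⟨H, hH, hHW⟩ := hνac.exists_modulus hT
  have hW : AbsolutelyContinuousOnInterval (fun s => W2 (μ s) (ν s)) 0 T := by
    refine absolutelyContinuousOnInterval_of_dist_le_add hG hH ?_
    rw [uIcc_of_le hT.le]
    intro s hs t ht
    rw [Real.dist_eq, Real.dist_eq, Real.dist_eq, abs_sub_comm, abs_sub_comm (G s),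
      abs_sub_comm (H s)]
    refine (abs_W2_sub_W2_le (hμ2 s hs) (hν2 s hs) (hμ2 t ht) (hν2 t ht)).trans ?_
    rw [W2_comm (μ s), W2_comm (ν s)]
    exact add_le_add (hGW t ht s hs) (hHW t ht s hs)
  filter_upwards [hue.ae_forall_hasDerivAt_integral hT hμ2 hG hGW hum huL2,
    hve.ae_forall_hasDerivAt_integral hT hν2 hH hHW hvm hvL2,
    ae_restrict_of_ae hW.ae_differentiableAt] with t htμ htν htW π hπ
  obtain ⟨ht, hut, ⟨K, hK, hKt⟩, hμu⟩ := htμ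
  obtain ⟨-, hvt, ⟨L, hL, hLt⟩, hνv⟩ := htν
  have hnhds : Icc 0 T ∈ 𝓝 t := Icc_mem_nhds ht.1 ht.2
  have hD := ((htW (by rw [uIcc_of_le hT.le]; exact Ioo_subset_Icc_self ht)).pow 2).hasDerivAt
  have hD' := hπ.eq_of_hasDerivAt_W2_sq hD (eventually_of_mem hnhds hμ2)
    (eventually_of_mem hnhds hν2) hut hvt hK hL hKt hLt hμu hνv
  rw [← hD']
  exact hD
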